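/- arXiv:2604.04296 — 2 statements merged into one kernel-verified Lean document; each statement's English description precedes it below -/
import Mathlib

section
/- For any circuit (a continuous map f : [a,b] → ℝ² that is injective except f(a) = f(b)), the complement ℝ² \ f([a,b]) is disconnected. -/
/-- A circuit: a continuous map on `[a,b]` (with `a < b`) such that
`f x = f y` for `x ≠ y` iff `{x, y} = {a, b}`. -/
def IsCircuit (f : ℝ → ℝ × ℝ) (a b : ℝ) : Prop :=
  a < b ∧ ContinuousOn f (Set.Icc a b) ∧
    ∀ x ∈ Set.Icc a b, ∀ y ∈ Set.Icc a b, x ≠ y →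
      (f x = f y ↔ ({x, y} : Set ℝ) = {a, b})

open Set Complex

theorem wj_const_of_exp (D : ℝ → ℂ) (hD : Continuous D) (c : ℂ) (h : ∀ t, exp (D t) = c) (x y : ℝ) :
    D x = D y := by
  have := isCoveringMap_exp.eq_of_comp_eq (A := ℝ) (g₁ := D) (g₂ := fun _ => D y) hD continuous_const
    (by funext t; simp [h]) y rfl
  exact congrFun this x

theorem wj_edge (G L : ℝ → ℂ) (hG : Continuous G) (hL : Continuous L) (hGL : ∀ t, exp (L t) = G t)
    (c : ℂ) (hc : c ≠ 0) (h : ∀ t, 0 ≤ (c * G t).re) :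
    L 1 - log (c * G 1) = L 0 - log (c * G 0) := by
  have hne : ∀ t, c * G t ≠ 0 := fun t => mul_ne_zero hc (by rw [← hGL]; exact exp_ne_zero _)
  refine wj_const_of_exp (fun t => L t - log (c * G t)) ?_ (c⁻¹) ?_ 1 0
  · refine hL.sub (Continuous.clog (by fun_prop) fun t => ?_)
    rw [mem_slitPlane_iff]
    rcases (h t).lt_or_eq with h1 | h1
    · exact Or.inl h1
    · right
      intro h2
      exact hne t (Complex.ext h1.symm h2)
  · intro t
    have h2 : G t ≠ 0 := right_ne_zero_of_mul (hne t)
    rw [exp_sub, exp_log (hne t), hGL]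
    field_simp

theorem wj_log_I_mul (w : ℂ) (hw : w ≠ 0) (h : 0 ≤ w.re) :
    log (I * w) = log w + (Real.pi / 2 : ℝ) * I := by
  have h1 := abs_le.1 (Complex.abs_arg_le_pi_div_two_iff.2 h)
  have hp := Real.pi_pos
  rw [(Complex.log_mul_eq_add_log_iff I_ne_zero hw).2 ?_, log_I]
  · push_cast; ring
  · rw [arg_I]; constructor <;> linarith

/-- Crossing lemma. -/
theorem wj_cross (A B : Set (ℝ × ℝ)) (p q r s : ℝ × ℝ) (hA : JoinedIn A p q) (hB : JoinedIn B r s)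
    (h1 : ∀ z ∈ B, p.1 ≤ z.1) (h2 : ∀ z ∈ B, z.1 ≤ q.1)
    (h3 : ∀ z ∈ A, r.2 ≤ z.2) (h4 : ∀ z ∈ A, z.2 ≤ s.2) : ∃ z, z ∈ A ∧ z ∈ B := by
  by_contra hcon
  push Not at hcon
  obtain ⟨γ, hγ⟩ := hA
  obtain ⟨δ, hδ⟩ := hB
  have hγ' : ∀ t : ℝ, γ.extend t ∈ A := fun t => hγ _
  have hδ' : ∀ t : ℝ, δ.extend t ∈ B := fun t => hδ _
  have cγ : Continuous γ.extend := γ.continuous_extend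
  have cδ : Continuous δ.extend := δ.continuous_extend
  have γ0 : γ.extend 0 = p := γ.extend_zero
  have γ1 : γ.extend 1 = q := γ.extend_one
  have δ0 : δ.extend 0 = r := δ.extend_zero
  have δ1 : δ.extend 1 = s := δ.extend_one
  generalize γ.extend = g at *
  generalize δ.extend = d at *
  let F : C(ℝ × ℝ, ℂ) := ⟨fun x => ((((g x.1).1 - (d x.2).1 : ℝ) : ℂ) + (((g x.1).2 - (d x.2).2 : ℝ) : ℂ) * I),
    by fun_prop⟩
  have hFre : ∀ x y, (F (x, y)).re = (g x).1 - (d y).1 := fun x y => by simp [F]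
  have hFim : ∀ x y, (F (x, y)).im = (g x).2 - (d y).2 := fun x y => by simp [F]
  have hF : ∀ x, F x ≠ 0 := by
    rintro ⟨x, y⟩ h0
    have e1 := hFre x y
    have e2 := hFim x y
    rw [h0] at e1 e2
    simp only [zero_re, zero_im] at e1 e2
    refine hcon (g x) (hγ' x) ?_
    have : g x = d y := Prod.ext (by linarith) (by linarith)
    rw [this]; exact hδ' y
  obtain ⟨L, ⟨-, hL⟩, -⟩ := isCoveringMapOn_exp.existsUnique_continuousMap_lifts F
    (a₀ := (0, 0)) (e₀ := log (F (0, 0))) (exp_log (hF _)) (fun a => hF a)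
  have hL' : ∀ x, exp (L x) = F x := fun x => congrFun hL x
  have e1 := wj_edge (fun t => F (t, 0)) (fun t => L (t, 0)) (by fun_prop) (by fun_prop)
    (fun t => hL' _) (-I) (by simp) (fun t => by
      have := h3 _ (hγ' t); simp [hFim, δ0]; linarith)
  have e2 := wj_edge (fun t => F (1, t)) (fun t => L (1, t)) (by fun_prop) (by fun_prop)
    (fun t => hL' _) 1 (by simp) (fun t => by
      have := h2 _ (hδ' t); simp [hFre, γ1]; linarith)
  have e3 := wj_edge (fun t => F (t, 1)) (fun t => L (t, 1)) (by fun_prop) (by fun_prop)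
    (fun t => hL' _) I (by simp) (fun t => by
      have := h4 _ (hγ' t); simp [hFim, δ1]; linarith)
  have e4 := wj_edge (fun t => F (0, t)) (fun t => L (0, t)) (by fun_prop) (by fun_prop)
    (fun t => hL' _) (-1) (by simp) (fun t => by
      have := h1 _ (hδ' t); simp [hFre, γ0]; linarith)
  have c10 := wj_log_I_mul (-I * F (1, 0)) (by simp [hF]) (by
      have := h3 _ (hγ' 1); simp [hFim, δ0]; linarith)
  have c11 := wj_log_I_mul (1 * F (1, 1)) (by simp [hF]) (by
      have := h2 _ (hδ' 1); simp [hFre, γ1]; linarith)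
  have c01 := wj_log_I_mul (I * F (0, 1)) (by simp [hF]) (by
      have := h4 _ (hγ' 0); simp [hFim, δ1]; linarith)
  have c00 := wj_log_I_mul (-1 * F (0, 0)) (by simp [hF]) (by
      have := h1 _ (hδ' 0); simp [hFre, γ0]; linarith)
  have a1 : I * (-I * F (1, 0)) = 1 * F (1, 0) := by linear_combination (-F (1,0)) * I_mul_I
  have a2 : I * (1 * F (1, 1)) = I * F (1, 1) := by ring
  have a3 : I * (I * F (0, 1)) = -1 * F (0, 1) := by linear_combination (F (0,1)) * I_mul_I
  have a4 : I * (-1 * F (0, 0)) = -I * F (0, 0) := by ring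
  rw [a1] at c10
  rw [a2] at c11
  rw [a3] at c01
  rw [a4] at c00
  have : ((Real.pi : ℝ) : ℂ) * I = 0 := by
    push_cast at c10 c11 c01 c00
    linear_combination (1/2) * (e1 + e2 - e3 - e4 - c10 - c11 - c01 - c00)
  simp [Real.pi_ne_zero] at this

theorem wj_exit {U O : Set (ℝ × ℝ)} (hO : IsOpen O) {x y : ℝ × ℝ} (h : JoinedIn U x y) (hx : x ∈ O)
    (hy : y ∉ O) : ∃ w, w ∉ O ∧ JoinedIn (U ∩ closure O) x w := by
  obtain ⟨γ, hγ⟩ := h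
  have hγ' : ∀ t : ℝ, γ.extend t ∈ U := fun t => hγ _
  have cγ : Continuous γ.extend := γ.continuous_extend
  have γ0 : γ.extend 0 = x := γ.extend_zero
  have γ1 : γ.extend 1 = y := γ.extend_one
  generalize γ.extend = g at *
  let S : Set ℝ := {t | 0 ≤ t ∧ g t ∉ O}
  have hS : IsClosed S := by
    have : S = Ici 0 ∩ g ⁻¹' Oᶜ := rfl
    rw [this]
    exact isClosed_Ici.inter (hO.isClosed_compl.preimage cγ)
  have hne : S.Nonempty := ⟨1, by norm_num, by rw [γ1]; exact hy⟩
  have hbd : BddBelow S := ⟨0, fun t ht => ht.1⟩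
  have hT := hS.csInf_mem hne hbd
  set T := sInf S with hTdef
  have hlt : ∀ t, 0 ≤ t → t < T → g t ∈ O := by
    intro t h0 ht
    by_contra hc
    exact absurd (csInf_le hbd (show t ∈ S from ⟨h0, hc⟩)) (not_le.2 ht)
  have hTpos : 0 < T := by
    rcases hT.1.lt_or_eq with h | h
    · exact h
    · exact absurd (by rw [← h, γ0]; exact hx) hT.2
  have hcl : ∀ t ∈ Icc 0 T, g t ∈ closure O := by
    intro t ht
    have h1 : t ∈ closure (Ico 0 T) := by rw [closure_Ico hTpos.ne]; exact ht
    exact closure_mono (by rintro _ ⟨u, hu, rfl⟩; exact hlt u hu.1 hu.2)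
      (image_closure_subset_closure_image cγ ⟨t, h1, rfl⟩)
  refine ⟨g T, hT.2, JoinedIn.ofLine (f := fun u => g (T * u)) (by fun_prop) (by simp [γ0]) (by simp) ?_⟩
  rintro _ ⟨u, hu, rfl⟩
  exact ⟨hγ' _, hcl _ ⟨mul_nonneg hTpos.le hu.1, mul_le_of_le_one_right hTpos.le hu.2⟩⟩

theorem wj_vert {S : Set (ℝ × ℝ)} {c u v : ℝ} (h : ∀ y ∈ uIcc u v, (c, y) ∈ S) :
    JoinedIn S (c, u) (c, v) := by
  have h1 : IsPathConnected (uIcc u v) := (convex_uIcc u v).isPathConnected ⟨u, left_mem_uIcc⟩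
  have h2 := (h1.joinedIn u left_mem_uIcc v right_mem_uIcc).map (f := fun y : ℝ => (c, y)) (by fun_prop)
  exact h2.mono (by rintro _ ⟨y, hy, rfl⟩; exact h y hy)

theorem wj_horiz {S : Set (ℝ × ℝ)} {c u v : ℝ} (h : ∀ x ∈ uIcc u v, (x, c) ∈ S) :
    JoinedIn S (u, c) (v, c) := by
  have h1 : IsPathConnected (uIcc u v) := (convex_uIcc u v).isPathConnected ⟨u, left_mem_uIcc⟩
  have h2 := (h1.joinedIn u left_mem_uIcc v right_mem_uIcc).map (f := fun x : ℝ => (x, c)) (by fun_prop)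
  exact h2.mono (by rintro _ ⟨y, hy, rfl⟩; exact h y hy)

/-- The part of a wide box avoiding `A` and two horizontal whiskers at `P` and `Q`. -/
def wjV (P Q : ℝ × ℝ) (y0 y1 : ℝ) (A : Set (ℝ × ℝ)) : Set (ℝ × ℝ) :=
  {z | P.1 - 1 ≤ z.1 ∧ z.1 ≤ Q.1 + 1 ∧ y0 ≤ z.2 ∧ z.2 ≤ y1 ∧ z ∉ A ∧
    ¬ (z.1 ≤ P.1 ∧ z.2 = P.2) ∧ ¬ (Q.1 ≤ z.1 ∧ z.2 = Q.2)}

theorem wj_block (A : Set (ℝ × ℝ)) (P Q : ℝ × ℝ) (y0 y1 c : ℝ)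
    (jA : JoinedIn (A ∪ {P, Q}) P Q) (hy : ∀ z ∈ A ∪ {P, Q}, y0 < z.2 ∧ z.2 < y1) :
    ¬ JoinedIn (wjV P Q y0 y1 A) (c, y0) (c, y1) := by
  intro hV
  let A' : Set (ℝ × ℝ) := (A ∪ {P, Q}) ∪ ({z | z.1 ≤ P.1 ∧ z.2 = P.2} ∪ {z | Q.1 ≤ z.1 ∧ z.2 = Q.2})
  have hP : y0 < P.2 ∧ P.2 < y1 := hy P (by simp)
  have hQ : y0 < Q.2 ∧ Q.2 < y1 := hy Q (by simp)
  have j1 : JoinedIn A' (P.1 - 1, P.2) (P.1, P.2) := wj_horiz (fun x hx => by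
    rw [uIcc_of_le (by linarith)] at hx
    right; left; exact ⟨hx.2, rfl⟩)
  have j2 : JoinedIn A' (Q.1, Q.2) (Q.1 + 1, Q.2) := wj_horiz (fun x hx => by
    rw [uIcc_of_le (by linarith)] at hx
    right; right; exact ⟨hx.1, rfl⟩)
  have j := (j1.trans (jA.mono subset_union_left)).trans j2
  have hA' : ∀ z ∈ A', y0 < z.2 ∧ z.2 < y1 := by
    rintro z (hz | ⟨-, hz⟩ | ⟨-, hz⟩)
    · exact hy z hz
    · rw [hz]; exact hP
    · rw [hz]; exact hQ
  obtain ⟨z, hz, hz'⟩ := wj_cross A' _ _ _ _ _ j hV (fun z hz => hz.1) (fun z hz => hz.2.1)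
    (fun z hz => (hA' z hz).1.le) (fun z hz => (hA' z hz).2.le)
  obtain ⟨-, -, -, -, k1, k2, k3⟩ := hz'
  rcases hz with (hz | hz | hz) | hz | hz
  · exact k1 hz
  · subst hz; exact k2 ⟨le_rfl, rfl⟩
  · rw [mem_singleton_iff] at hz; subst hz; exact k3 ⟨le_rfl, rfl⟩
  · exact k2 hz
  · exact k3 hz

/-- From a boundary point off the curve one can go to the top or the bottom. -/
theorem wj_around (J : Set (ℝ × ℝ)) (P Q : ℝ × ℝ) (y0 y1 c : ℝ) (hPJ : P ∈ J) (hQJ : Q ∈ J)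
    (hc : P.1 < c ∧ c < Q.1)
    (hx : ∀ z ∈ J, P.1 ≤ z.1 ∧ z.1 ≤ Q.1) (hy : ∀ z ∈ J, y0 < z.2 ∧ z.2 < y1)
    (w : ℝ × ℝ) (hw1 : w ∉ Ioo P.1 Q.1 ×ˢ Ioo y0 y1) (hw2 : w ∈ Icc P.1 Q.1 ×ˢ Icc y0 y1)
    (hwJ : w ∉ J) :
    JoinedIn (wjV P Q y0 y1 J) w (c, y0) ∨ JoinedIn (wjV P Q y0 y1 J) w (c, y1) := by
  obtain ⟨u, v⟩ := w
  have hP := hy P hPJ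
  have hQ := hy Q hQJ
  obtain ⟨⟨b1, b2⟩, b3, b4⟩ := hw2
  simp only at b1 b2 b3 b4
  have bot : ∀ t, P.1 - 1 ≤ t → t ≤ Q.1 + 1 → JoinedIn (wjV P Q y0 y1 J) (t, y0) (c, y0) := by
    intro t h1 h2
    refine wj_horiz fun x hx' => ?_
    have hx1 : P.1 - 1 ≤ x ∧ x ≤ Q.1 + 1 := by
      rcases le_total t c with h | h
      · rw [uIcc_of_le h] at hx'; constructor <;> linarith [hx'.1, hx'.2]
      · rw [uIcc_of_ge h] at hx'; constructor <;> linarith [hx'.1, hx'.2]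
    refine ⟨hx1.1, hx1.2, le_rfl, (hP.1.trans hP.2).le, fun hJ => (hy _ hJ).1.false, ?_, ?_⟩
    · rintro ⟨-, h⟩; simp only at h; linarith
    · rintro ⟨-, h⟩; simp only at h; linarith
  have top : ∀ t, P.1 - 1 ≤ t → t ≤ Q.1 + 1 → JoinedIn (wjV P Q y0 y1 J) (t, y1) (c, y1) := by
    intro t h1 h2
    refine wj_horiz fun x hx' => ?_
    have hx1 : P.1 - 1 ≤ x ∧ x ≤ Q.1 + 1 := by
      rcases le_total t c with h | h
      · rw [uIcc_of_le h] at hx'; constructor <;> linarith [hx'.1, hx'.2]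
      · rw [uIcc_of_ge h] at hx'; constructor <;> linarith [hx'.1, hx'.2]
    refine ⟨hx1.1, hx1.2, (hP.1.trans hP.2).le, le_rfl, fun hJ => (hy _ hJ).2.false, ?_, ?_⟩
    · rintro ⟨-, h⟩; simp only at h; linarith
    · rintro ⟨-, h⟩; simp only at h; linarith
  by_cases e1 : u = P.1
  · have hne : v ≠ P.2 := fun h => hwJ (by rw [e1, h]; exact hPJ)
    have s1 : JoinedIn (wjV P Q y0 y1 J) (u, v) (P.1 - 1, v) := by
      refine wj_horiz fun x hx' => ?_
      rw [uIcc_of_ge (by linarith)] at hx'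
      refine ⟨hx'.1, by linarith [hx'.2], b3, b4, fun hJ => ?_, fun h => hne h.2,
        fun h => by linarith [hx'.2, h.1]⟩
      have : x = u := le_antisymm hx'.2 (by rw [e1]; exact (hx _ hJ).1)
      exact hwJ (this ▸ hJ)
    have side : ∀ y, y0 ≤ y → y ≤ y1 → y ≠ P.2 → (P.1 - 1, y) ∈ wjV P Q y0 y1 J := by
      intro y h0 h1 h2
      refine ⟨le_rfl, by simp only; linarith, h0, h1, fun hJ => ?_, fun h => h2 h.2, fun h => ?_⟩
      · have := (hx _ hJ).1; simp only at this; linarith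
      · have := h.1; simp only at this; linarith
    rcases lt_or_gt_of_ne hne with h | h
    · left
      refine (s1.trans (wj_vert fun y hy' => ?_)).trans (bot _ le_rfl (by linarith))
      rw [uIcc_of_ge b3] at hy'
      exact side y hy'.1 (by linarith [hy'.2]) (by linarith [hy'.2] : y < P.2).ne
    · right
      refine (s1.trans (wj_vert fun y hy' => ?_)).trans (top _ le_rfl (by linarith))
      rw [uIcc_of_le b4] at hy'
      exact side y (by linarith [hy'.1]) hy'.2 (by linarith [hy'.1] : P.2 < y).ne'
  by_cases e2 : u = Q.1
  · have hne : v ≠ Q.2 := fun h => hwJ (by rw [e2, h]; exact hQJ)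
    have s1 : JoinedIn (wjV P Q y0 y1 J) (u, v) (Q.1 + 1, v) := by
      refine wj_horiz fun x hx' => ?_
      rw [uIcc_of_le (by linarith)] at hx'
      refine ⟨by linarith [hx'.1], hx'.2, b3, b4, fun hJ => ?_, 
        fun h => by linarith [hx'.1, h.1], fun h => hne h.2⟩
      have : x = u := le_antisymm (by rw [e2]; exact (hx _ hJ).2) hx'.1
      exact hwJ (this ▸ hJ)
    have side : ∀ y, y0 ≤ y → y ≤ y1 → y ≠ Q.2 → (Q.1 + 1, y) ∈ wjV P Q y0 y1 J := by
      intro y h0 h1 h2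
      refine ⟨by simp only; linarith, le_rfl, h0, h1, fun hJ => ?_, fun h => ?_, fun h => h2 h.2⟩
      · have := (hx _ hJ).2; simp only at this; linarith
      · have := h.1; simp only at this; linarith
    rcases lt_or_gt_of_ne hne with h | h
    · left
      refine (s1.trans (wj_vert fun y hy' => ?_)).trans (bot _ (by linarith) le_rfl)
      rw [uIcc_of_ge b3] at hy'
      exact side y hy'.1 (by linarith [hy'.2]) (by linarith [hy'.2] : y < Q.2).ne
    · right
      refine (s1.trans (wj_vert fun y hy' => ?_)).trans (top _ (by linarith) le_rfl)
      rw [uIcc_of_le b4] at hy'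
      exact side y (by linarith [hy'.1]) hy'.2 (by linarith [hy'.1] : Q.2 < y).ne'
  by_cases e3 : v = y0
  · left; rw [e3]; exact bot _ (by linarith) (by linarith)
  by_cases e4 : v = y1
  · right; rw [e4]; exact top _ (by linarith) (by linarith)
  exact absurd ⟨⟨lt_of_le_of_ne b1 (Ne.symm e1), lt_of_le_of_ne b2 e2⟩,
    lt_of_le_of_ne b3 (Ne.symm e3), lt_of_le_of_ne b4 e4⟩ hw1

theorem wjV_anti {P Q : ℝ × ℝ} {y0 y1 : ℝ} {A B : Set (ℝ × ℝ)} (h : A ⊆ B) :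
    wjV P Q y0 y1 B ⊆ wjV P Q y0 y1 A := by
  rintro z ⟨k1, k2, k3, k4, k5, k6⟩
  exact ⟨k1, k2, k3, k4, fun hz => k5 (h hz), k6⟩

/-- Highest point of a compact set on a vertical line, below some height. -/
theorem wj_top (K : Set (ℝ × ℝ)) (hK : IsCompact K) (c b : ℝ) (hne : ∃ y, y ≤ b ∧ (c, y) ∈ K) :
    ∃ y, y ≤ b ∧ (c, y) ∈ K ∧ ∀ y', y' ≤ b → (c, y') ∈ K → y' ≤ y := by
  have hc : IsCompact (K ∩ {z | z.1 = c ∧ z.2 ≤ b}) :=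
    hK.inter_right ((isClosed_eq continuous_fst continuous_const).inter
      (isClosed_le continuous_snd continuous_const))
  obtain ⟨y, hy, hyK⟩ := hne
  obtain ⟨z, ⟨hz1, hz2, hz3⟩, hz⟩ := hc.exists_isMaxOn ⟨(c, y), hyK, rfl, hy⟩ continuous_snd.continuousOn
  refine ⟨z.2, hz3, by rw [← hz2]; exact hz1, fun y' h1 h2 => hz ⟨h2, rfl, h1⟩⟩

theorem wj_bot (K : Set (ℝ × ℝ)) (hK : IsCompact K) (c : ℝ) (hne : ∃ y, (c, y) ∈ K) :
    ∃ y, (c, y) ∈ K ∧ ∀ y', (c, y') ∈ K → y ≤ y' := by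
  have hc : IsCompact (K ∩ {z | z.1 = c}) :=
    hK.inter_right (isClosed_eq continuous_fst continuous_const)
  obtain ⟨y, hyK⟩ := hne
  obtain ⟨z, ⟨hz1, hz2⟩, hz⟩ := hc.exists_isMinOn ⟨(c, y), hyK, rfl⟩ continuous_snd.continuousOn
  refine ⟨z.2, by rw [← show z.1 = c from hz2]; exact hz1, fun y' h2 => hz ⟨h2, rfl⟩⟩

theorem wj_core (A B : Set (ℝ × ℝ)) (P Q : ℝ × ℝ) (c l : ℝ)
    (hA : IsPathConnected A) (hB : IsPathConnected B) (hAB : Disjoint A B)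
    (hPA : P ∉ A) (hQA : Q ∉ A) (hPB : P ∉ B) (hQB : Q ∉ B)
    (jA : JoinedIn (A ∪ {P, Q}) P Q) (jB : JoinedIn (B ∪ {P, Q}) P Q)
    (cA : IsCompact (A ∪ {P, Q})) (cB : IsCompact (B ∪ {P, Q}))
    (hc : P.1 < c ∧ c < Q.1) (hx : ∀ z ∈ A ∪ B, P.1 ≤ z.1 ∧ z.1 ≤ Q.1)
    (hl : (c, l) ∈ A) (hl' : ∀ y, (c, y) ∈ A ∪ B → y ≤ l) :
    ¬ IsPreconnected ((A ∪ B ∪ {P, Q})ᶜ) := by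
  intro hpre
  set J := A ∪ B ∪ {P, Q} with hJ
  have cJ : IsCompact J := by
    have : J = (A ∪ {P, Q}) ∪ (B ∪ {P, Q}) := by
      rw [hJ]; ext z; simp only [mem_union]; tauto
    rw [this]; exact cA.union cB
  have hAJ : A ⊆ J := fun z hz => Or.inl (Or.inl hz)
  have hBJ : B ⊆ J := fun z hz => Or.inl (Or.inr hz)
  have hPJ : P ∈ J := by right; simp
  have hQJ : Q ∈ J := by right; simp
  have hxJ : ∀ z ∈ J, P.1 ≤ z.1 ∧ z.1 ≤ Q.1 := by
    rintro z (hz | hz | hz)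
    · exact hx z hz
    · rw [hz]; exact ⟨le_rfl, by linarith⟩
    · rw [mem_singleton_iff] at hz; rw [hz]; exact ⟨by linarith, le_rfl⟩
  obtain ⟨y0, y1, hyJ⟩ : ∃ y0 y1, ∀ z ∈ J, y0 < z.2 ∧ z.2 < y1 := by
    obtain ⟨m, hm⟩ := (cJ.image continuous_snd).bddBelow
    obtain ⟨M, hM⟩ := (cJ.image continuous_snd).bddAbove
    refine ⟨m - 1, M + 1, fun z hz => ?_⟩
    have h1 := hm ⟨z, hz, rfl⟩
    have h2 := hM ⟨z, hz, rfl⟩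
    constructor <;> linarith
  have hyl := hyJ _ (hAJ hl)
  simp only at hyl
  have blockA := wj_block A P Q y0 y1 c jA (fun z hz => hyJ z (by
    rcases hz with hz | hz
    · exact hAJ hz
    · exact Or.inr hz))
  have blockB := wj_block B P Q y0 y1 c jB (fun z hz => hyJ z (by
    rcases hz with hz | hz
    · exact hBJ hz
    · exact Or.inr hz))
  -- on the line the closed arcs agree with the open ones
  have lineA : ∀ y, (c, y) ∈ A ∪ {P, Q} → (c, y) ∈ A := by
    rintro y (h | h | h)
    · exact h
    · have := congrArg Prod.fst h; simp only at this; linarith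
    · have := congrArg Prod.fst h; simp only at this; linarith
  have lineB : ∀ y, (c, y) ∈ B ∪ {P, Q} → (c, y) ∈ B := by
    rintro y (h | h | h)
    · exact h
    · have := congrArg Prod.fst h; simp only at this; linarith
    · have := congrArg Prod.fst h; simp only at this; linarith
  have lineV : ∀ S y, y0 ≤ y → y ≤ y1 → (c, y) ∉ S → (c, y) ∈ wjV P Q y0 y1 S := by
    intro S y h0 h1 h2
    exact ⟨by simp only; linarith, by simp only; linarith, h0, h1, h2,
      fun h => by have := h.1; simp only at this; linarith,
      fun h => by have := h.1; simp only at this; linarith⟩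
  have arcV : ∀ S T : Set (ℝ × ℝ), S ⊆ J → P ∉ S → Q ∉ S → Disjoint S T → S ⊆ wjV P Q y0 y1 T := by
    intro S T hSJ hP hQ hd z hz
    have h1 := hxJ z (hSJ hz)
    have h2 := hyJ z (hSJ hz)
    refine ⟨by linarith, by linarith, h2.1.le, h2.2.le, fun h => disjoint_left.1 hd hz h, ?_, ?_⟩
    · rintro ⟨k1, k2⟩
      exact hP (by rwa [show P = z from Prod.ext (le_antisymm h1.1 k1) k2.symm])
    · rintro ⟨k1, k2⟩
      exact hQ (by rwa [show Q = z from Prod.ext (le_antisymm k1 h1.2) k2.symm])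
  have arcA := arcV A B hAJ hPA hQA hAB
  have arcB := arcV B A hBJ hPB hQB hAB.symm
  obtain ⟨m, hmA, hm⟩ := wj_bot _ cA c ⟨l, Or.inl hl⟩
  replace hmA := lineA _ hmA
  replace hm : ∀ y', (c, y') ∈ A → m ≤ y' := fun y' h => hm y' (Or.inl h)
  have hym := hyJ _ (hAJ hmA)
  simp only at hym
  -- from m to the top avoiding B
  have pm : JoinedIn (wjV P Q y0 y1 B) (c, m) (c, y1) := by
    refine ((hA.joinedIn _ hmA _ hl).mono arcA).trans (wj_vert fun y hy => ?_)
    rw [uIcc_of_le hyl.2.le] at hy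
    refine lineV _ _ (by linarith [hy.1]) hy.2 fun hyB => ?_
    have : y = l := le_antisymm (hl' y (Or.inr hyB)) hy.1
    exact disjoint_left.1 hAB hl (this ▸ hyB)
  have hex : ∃ y, y ≤ m ∧ (c, y) ∈ B ∪ {P, Q} := by
    by_contra hcon
    push Not at hcon
    refine blockB (JoinedIn.trans (wj_vert fun y hy => ?_) pm)
    rw [uIcc_of_le hym.1.le] at hy
    exact lineV _ _ hy.1 (by linarith [hy.2]) fun h => hcon y hy.2 (Or.inl h)
  obtain ⟨p, hpm, hpB, hp⟩ := wj_top _ cB c m hex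
  obtain ⟨q, hqB, hq⟩ := wj_bot _ cB c ⟨p, hpB⟩
  have hqp := hq p hpB
  replace hpB := lineB _ hpB
  replace hqB := lineB _ hqB
  have hpm' : p < m := lt_of_le_of_ne hpm fun h => disjoint_left.1 hAB hmA (h ▸ hpB)
  have hyq := hyJ _ (hBJ hqB)
  simp only at hyq
  -- the key point
  set k := (p + m) / 2 with hk
  have hkp : p < k := by rw [hk]; linarith
  have hkm : k < m := by rw [hk]; linarith
  have notA : ∀ y, y < m → (c, y) ∉ A := fun y h1 h2 => absurd (hm y h2) (not_le.2 h1)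
  have notB : ∀ y, p < y → y ≤ m → (c, y) ∉ B :=
    fun y h1 h2 h3 => absurd (hp y h2 (Or.inl h3)) (not_le.2 h1)
  have up : JoinedIn (wjV P Q y0 y1 B) (c, k) (c, y1) := by
    refine JoinedIn.trans (wj_vert fun y hy => ?_) pm
    rw [uIcc_of_le hkm.le] at hy
    exact lineV _ _ (by linarith [hy.1]) (by linarith [hy.2]) (notB _ (by linarith [hy.1]) hy.2)
  have down : JoinedIn (wjV P Q y0 y1 A) (c, k) (c, y0) := by
    refine (JoinedIn.trans (wj_vert (v := p) fun y hy => ?_)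
      ((hB.joinedIn _ hpB _ hqB).mono arcB)).trans (wj_vert fun y hy => ?_)
    · rw [uIcc_of_ge hkp.le] at hy
      exact lineV _ _ (by linarith [hy.1]) (by linarith [hy.2]) (notA _ (by linarith [hy.2]))
    · rw [uIcc_of_ge hyq.1.le] at hy
      exact lineV _ _ hy.1 (by linarith [hy.2]) (notA _ (by linarith [hy.2]))
  have hkJ : (c, k) ∈ Jᶜ := by
    rintro ((h | h) | h)
    · exact notA _ hkm h
    · exact notB _ hkp hkm.le h
    · exact notA _ hkm (lineA _ (Or.inr h))
  have hfar : (c, y1) ∈ Jᶜ := fun h => (hyJ _ h).2.false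
  have hpc : IsPathConnected Jᶜ :=
    (cJ.isClosed.isOpen_compl.isConnected_iff_isPathConnected).1 ⟨⟨_, hfar⟩, hpre⟩
  have hO : IsOpen (Ioo P.1 Q.1 ×ˢ Ioo y0 y1) := isOpen_Ioo.prod isOpen_Ioo
  obtain ⟨w, hw, jw⟩ := wj_exit hO (hpc.joinedIn _ hkJ _ hfar)
    ⟨hc, by simp only; linarith, by simp only; linarith⟩ (fun h => h.2.2.false)
  rw [closure_prod_eq, closure_Ioo (by linarith), closure_Ioo (by linarith)] at jw
  have jw' : JoinedIn (wjV P Q y0 y1 J) (c, k) w := by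
    refine jw.mono ?_
    rintro z ⟨hz, ⟨a1, a2⟩, a3, a4⟩
    refine ⟨by linarith, by linarith, a3, a4, hz, ?_, ?_⟩
    · rintro ⟨k1, k2⟩
      exact hz (by rwa [show z = P from Prod.ext (le_antisymm k1 a1) k2])
    · rintro ⟨k1, k2⟩
      exact hz (by rwa [show z = Q from Prod.ext (le_antisymm a2 k1) k2])
  have hwm := jw.target_mem
  rcases wj_around J P Q y0 y1 c hPJ hQJ hc hxJ hyJ w hw hwm.2 hwm.1 with h | h
  · exact blockB (((jw'.trans h).mono (wjV_anti hBJ)).symm.trans up)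
  · exact blockA (down.symm.trans ((jw'.trans h).mono (wjV_anti hAJ)))

theorem wj_core' (A B : Set (ℝ × ℝ)) (P Q : ℝ × ℝ)
    (hA : IsPathConnected A) (hB : IsPathConnected B) (hAB : Disjoint A B)
    (hPA : P ∉ A) (hQA : Q ∉ A) (hPB : P ∉ B) (hQB : Q ∉ B)
    (jA : JoinedIn (A ∪ {P, Q}) P Q) (jB : JoinedIn (B ∪ {P, Q}) P Q)
    (cA : IsCompact (A ∪ {P, Q})) (cB : IsCompact (B ∪ {P, Q}))
    (hPQ : P.1 < Q.1) (hx : ∀ z ∈ A ∪ B, P.1 ≤ z.1 ∧ z.1 ≤ Q.1) :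
    ¬ IsPreconnected ((A ∪ B ∪ {P, Q})ᶜ) := by
  set c := (P.1 + Q.1) / 2 with hcdef
  have hc : P.1 < c ∧ c < Q.1 := by constructor <;> (rw [hcdef]; linarith)
  have cJ : IsCompact ((A ∪ {P, Q}) ∪ (B ∪ {P, Q})) := cA.union cB
  have line : ∀ y, (c, y) ∈ (A ∪ {P, Q}) ∪ (B ∪ {P, Q}) → (c, y) ∈ A ∪ B := by
    intro y h
    have h1 : (c, y) ≠ P := fun h => by have := congrArg Prod.fst h; simp only at this; linarith
    have h2 : (c, y) ≠ Q := fun h => by have := congrArg Prod.fst h; simp only at this; linarith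
    simp only [mem_union, mem_insert_iff, mem_singleton_iff] at h ⊢
    tauto
  obtain ⟨y2, hy2⟩ : ∃ y, (c, y) ∈ A ∪ {P, Q} := by
    obtain ⟨t, ht⟩ : c ∈ Prod.fst '' (A ∪ {P, Q}) := by
      obtain ⟨γ, hγ⟩ := jA
      have : c ∈ Icc (γ 0).1 (γ 1).1 := by simp [hc.1.le, hc.2.le]
      obtain ⟨t, ht⟩ := intermediate_value_univ (f := fun t => (γ t).1) 0 1 (by fun_prop) this
      exact ⟨γ t, hγ t, ht⟩
    exact ⟨t.2, by rw [← ht.2]; exact ht.1⟩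
  obtain ⟨M, hM⟩ := (cJ.image continuous_snd).bddAbove
  obtain ⟨l, -, hl, hl'⟩ := wj_top _ cJ c M ⟨y2, hM ⟨_, Or.inl hy2, rfl⟩, Or.inl hy2⟩
  have hl'' : ∀ y, (c, y) ∈ A ∪ B → y ≤ l := by
    intro y hy
    have hy' : (c, y) ∈ (A ∪ {P, Q}) ∪ (B ∪ {P, Q}) := by
      rcases hy with h | h
      · exact Or.inl (Or.inl h)
      · exact Or.inr (Or.inl h)
    exact hl' y (hM ⟨_, hy', rfl⟩) hy'
  rcases line l hl with h | h
  · exact wj_core A B P Q c l hA hB hAB hPA hQA hPB hQB jA jB cA cB hc hx h hl''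
  · rw [union_comm A B] at hx hl'' ⊢
    exact wj_core B A P Q c l hB hA hAB.symm hPB hQB hPA hQA jB jA cB cA hc hx h hl''

theorem wj_final (f : ℝ → ℝ × ℝ) (a b s t : ℝ) (P Q : ℝ × ℝ) (T : Set ℝ) (C : Set (ℝ × ℝ))
    (hf : ContinuousOn f (Icc a b))
    (inj : ∀ x ∈ Icc a b, ∀ y ∈ Icc a b, f x = f y → x = y ∨ (x = a ∧ y = b) ∨ (x = b ∧ y = a))
    (hs : a ≤ s) (hst : s < t) (ht : t ≤ b)
    (hT : IsPathConnected (f '' T)) (hC : IsPathConnected C) (hC' : IsCompact C)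
    (hTC : f '' T ∪ {f s, f t} = C) (hTab : T ⊆ Icc a b) (hTst : ∀ x ∈ T, x < s ∨ t < x)
    (hsa : s = a → b ∉ T) (htb : t = b → a ∉ T)
    (hcov : f '' Icc a b = f '' T ∪ f '' Icc s t)
    (hPQ : (P = f s ∧ Q = f t) ∨ (P = f t ∧ Q = f s)) (hlt : P.1 < Q.1)
    (hx : ∀ x ∈ Icc a b, P.1 ≤ (f x).1 ∧ (f x).1 ≤ Q.1) :
    ¬ IsPreconnected ((f '' Icc a b)ᶜ) := by
  have hsub : Icc s t ⊆ Icc a b := Icc_subset_Icc hs ht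
  have hset : ({P, Q} : Set (ℝ × ℝ)) = {f s, f t} := by
    rcases hPQ with ⟨h1, h2⟩ | ⟨h1, h2⟩
    · rw [h1, h2]
    · rw [h1, h2, pair_comm]
  have hmem : ∀ S : Set (ℝ × ℝ), f s ∈ S → f t ∈ S → P ∈ S ∧ Q ∈ S := by
    intro S h1 h2
    rcases hPQ with ⟨h3, h4⟩ | ⟨h3, h4⟩ <;> rw [h3, h4]
    exacts [⟨h1, h2⟩, ⟨h2, h1⟩]
  have hAC : f '' Ioo s t ∪ {f s, f t} = f '' Icc s t := by
    rw [← Ioo_union_both hst.le, image_union, image_pair]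
  have hdis : ∀ x ∈ T, ∀ y ∈ Icc s t, f x ≠ f y := by
    intro x hxT y hy h
    rcases inj x (hTab hxT) y (hsub hy) h with h | ⟨h1, h2⟩ | ⟨h1, h2⟩
    · subst h
      rcases hTst x hxT with h | h
      · exact absurd hy.1 (not_le.2 h)
      · exact absurd hy.2 (not_le.2 h)
    · exact htb (le_antisymm ht (h2 ▸ hy.2)) (h1 ▸ hxT)
    · exact hsa (le_antisymm (h2 ▸ hy.1) hs) (h1 ▸ hxT)
  have hA1 : ∀ y ∈ Ioo s t, ∀ x ∈ Icc a b, f y = f x → y = x := by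
    intro y hy x hx h
    rcases inj y (hsub ⟨hy.1.le, hy.2.le⟩) x hx h with h | ⟨h1, h2⟩ | ⟨h1, h2⟩
    · exact h
    · linarith [hy.1]
    · linarith [hy.2]
  have hcompl1 : P ∈ (f '' Ioo s t)ᶜ ∧ Q ∈ (f '' Ioo s t)ᶜ := by
    refine hmem _ ?_ ?_
    · rintro ⟨y, hy, h⟩
      exact hy.1.ne' (hA1 y hy s (hsub ⟨le_rfl, hst.le⟩) h)
    · rintro ⟨y, hy, h⟩
      exact hy.2.ne (hA1 y hy t (hsub ⟨hst.le, le_rfl⟩) h)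
  have hcompl2 : P ∈ (f '' T)ᶜ ∧ Q ∈ (f '' T)ᶜ := by
    refine hmem _ ?_ ?_
    · rintro ⟨y, hy, h⟩
      exact hdis y hy s ⟨le_rfl, hst.le⟩ h
    · rintro ⟨y, hy, h⟩
      exact hdis y hy t ⟨hst.le, le_rfl⟩ h
  have hpcA : IsPathConnected (f '' Ioo s t) :=
    ((convex_Ioo s t).isPathConnected (nonempty_Ioo.2 hst)).image'
      (hf.mono (Ioo_subset_Icc_self.trans hsub))
  have hpcA' : IsPathConnected (f '' Icc s t) :=
    ((convex_Icc s t).isPathConnected (nonempty_Icc.2 hst.le)).image' (hf.mono hsub)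
  have key := wj_core' (f '' Ioo s t) (f '' T) P Q hpcA hT ?_ hcompl1.1 hcompl1.2 hcompl2.1 hcompl2.2
    ?_ ?_ ?_ ?_ hlt ?_
  · rw [hset] at key
    convert key using 2
    rw [hcov, ← hAC, ← union_assoc, union_comm (f '' T)]
  · rw [disjoint_left]
    rintro _ ⟨y, hy, rfl⟩ ⟨x, hx, h⟩
    exact hdis x hx y ⟨hy.1.le, hy.2.le⟩ h
  · rw [hset, hAC]
    have := hmem (f '' Icc s t) ⟨s, ⟨le_rfl, hst.le⟩, rfl⟩ ⟨t, ⟨hst.le, le_rfl⟩, rfl⟩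
    exact hpcA'.joinedIn _ this.1 _ this.2
  · rw [hset, hTC]
    have := hmem C (by rw [← hTC]; simp) (by rw [← hTC]; simp)
    exact hC.joinedIn _ this.1 _ this.2
  · rw [hset, hAC]
    exact isCompact_Icc.image_of_continuousOn (hf.mono hsub)
  · rw [hset, hTC]; exact hC'
  · rintro z (⟨x, hx', rfl⟩ | ⟨x, hx', rfl⟩)
    · exact hx x (hsub ⟨hx'.1.le, hx'.2.le⟩)
    · exact hx x (hTab hx')

theorem wj_final2 (f : ℝ → ℝ × ℝ) (a b s t : ℝ) (P Q : ℝ × ℝ)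
    (hf : ContinuousOn f (Icc a b)) (hfab : f a = f b)
    (inj : ∀ x ∈ Icc a b, ∀ y ∈ Icc a b, f x = f y → x = y ∨ (x = a ∧ y = b) ∨ (x = b ∧ y = a))
    (hs : a ≤ s) (hst : s < t) (ht : t ≤ b)
    (hPQ : (P = f s ∧ Q = f t) ∨ (P = f t ∧ Q = f s)) (hlt : P.1 < Q.1)
    (hx : ∀ x ∈ Icc a b, P.1 ≤ (f x).1 ∧ (f x).1 ≤ Q.1) :
    ¬ IsPreconnected ((f '' Icc a b)ᶜ) := by
  have hne : f s ≠ f t := by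
    intro h
    rcases hPQ with ⟨h1, h2⟩ | ⟨h1, h2⟩ <;> rw [h1, h2, h] at hlt <;> exact lt_irrefl _ hlt
  have pc : ∀ S : Set ℝ, S ⊆ Icc a b → Convex ℝ S → S.Nonempty → IsPathConnected (f '' S) :=
    fun S h1 h2 h3 => (h2.isPathConnected h3).image' (hf.mono h1)
  have cp : ∀ x y, Icc x y ⊆ Icc a b → IsCompact (f '' Icc x y) :=
    fun x y h => isCompact_Icc.image_of_continuousOn (hf.mono h)
  by_cases e1 : s = a
  · have htb : t < b := lt_of_le_of_ne ht fun h => hne (by rw [e1, h, hfab])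
    have hsub : Icc t b ⊆ Icc a b := Icc_subset_Icc (by linarith) le_rfl
    have hu : f '' Ioo t b ∪ {f s, f t} = f '' Icc t b := by
      rw [← Ioo_union_both htb.le, image_union, image_pair, e1, hfab, pair_comm]
    refine wj_final f a b s t P Q (Ioo t b) (f '' Icc t b) hf inj hs hst ht
      (pc _ (Ioo_subset_Icc_self.trans hsub) (convex_Ioo _ _) (nonempty_Ioo.2 htb))
      (pc _ hsub (convex_Icc _ _) (nonempty_Icc.2 htb.le)) (cp _ _ hsub) hu
      (Ioo_subset_Icc_self.trans hsub) (fun x hx => Or.inr hx.1) (fun _ h => h.2.false)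
      (fun h => absurd h htb.ne) ?_ hPQ hlt hx
    have h1 : f '' Icc a b = f '' Icc t b ∪ f '' Icc s t := by
      rw [← image_union, union_comm, e1, Icc_union_Icc_eq_Icc (by linarith) ht]
    rw [h1, ← hu, union_assoc]
    congr 1
    refine union_eq_right.2 ?_
    rintro z (rfl | rfl)
    exacts [⟨s, ⟨le_rfl, hst.le⟩, rfl⟩, ⟨t, ⟨hst.le, le_rfl⟩, rfl⟩]
  have has : a < s := lt_of_le_of_ne hs (Ne.symm e1)
  by_cases e2 : t = b
  · have hsub : Icc a s ⊆ Icc a b := Icc_subset_Icc le_rfl (by linarith)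
    have hu : f '' Ioo a s ∪ {f s, f t} = f '' Icc a s := by
      rw [← Ioo_union_both has.le, image_union, image_pair, e2, hfab, pair_comm]
    refine wj_final f a b s t P Q (Ioo a s) (f '' Icc a s) hf inj hs hst ht
      (pc _ (Ioo_subset_Icc_self.trans hsub) (convex_Ioo _ _) (nonempty_Ioo.2 has))
      (pc _ hsub (convex_Icc _ _) (nonempty_Icc.2 has.le)) (cp _ _ hsub) hu
      (Ioo_subset_Icc_self.trans hsub) (fun x hx => Or.inl hx.2) (fun h => absurd h e1)
      (fun _ h => h.1.false) ?_ hPQ hlt hx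
    have h1 : f '' Icc a b = f '' Icc a s ∪ f '' Icc s t := by
      rw [← image_union, e2, Icc_union_Icc_eq_Icc has.le (by linarith)]
    rw [h1, ← hu, union_assoc]
    congr 1
    refine union_eq_right.2 ?_
    rintro z (rfl | rfl)
    exacts [⟨s, ⟨le_rfl, hst.le⟩, rfl⟩, ⟨t, ⟨hst.le, le_rfl⟩, rfl⟩]
  have htb : t < b := lt_of_le_of_ne ht e2
  have s1 : Icc a s ⊆ Icc a b := Icc_subset_Icc le_rfl (by linarith)
  have s2 : Icc t b ⊆ Icc a b := Icc_subset_Icc (by linarith) le_rfl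
  have hu : f '' (Ico a s ∪ Ioc t b) ∪ {f s, f t} = f '' Icc a s ∪ f '' Icc t b := by
    rw [← image_pair, ← image_union, ← image_union]
    congr 1
    ext x
    simp only [mem_union, mem_Ico, mem_Ioc, mem_Icc, mem_insert_iff, mem_singleton_iff]
    grind
  refine wj_final f a b s t P Q (Ico a s ∪ Ioc t b) (f '' Icc a s ∪ f '' Icc t b) hf inj hs hst ht
      ?_ ?_ ((cp _ _ s1).union (cp _ _ s2)) hu
      (union_subset (Ico_subset_Icc_self.trans s1) (Ioc_subset_Icc_self.trans s2))
      (fun x hx => hx.imp (fun h => h.2) (fun h => h.1)) (fun h => absurd h e1)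
      (fun h => absurd h e2) ?_ hPQ hlt hx
  · rw [image_union]
    exact (pc _ (Ico_subset_Icc_self.trans s1) (convex_Ico _ _) (nonempty_Ico.2 has)).union
      (pc _ (Ioc_subset_Icc_self.trans s2) (convex_Ioc _ _) (nonempty_Ioc.2 htb))
      ⟨f a, ⟨a, ⟨le_rfl, has⟩, rfl⟩, ⟨b, ⟨htb, le_rfl⟩, hfab.symm⟩⟩
  · exact (pc _ s1 (convex_Icc _ _) (nonempty_Icc.2 has.le)).union
      (pc _ s2 (convex_Icc _ _) (nonempty_Icc.2 htb.le))
      ⟨f a, ⟨a, ⟨le_rfl, has.le⟩, rfl⟩, ⟨b, ⟨htb.le, le_rfl⟩, hfab.symm⟩⟩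
  · rw [← image_union]
    congr 1
    ext x
    simp only [mem_union, mem_Ico, mem_Ioc, mem_Icc]
    grind

theorem wj_no_inj (g : ℝ → ℝ) (a b : ℝ) (hab : a < b) (hg : ContinuousOn g (Icc a b)) (h : g a = g b)
    (inj : ∀ x ∈ Icc a b, ∀ y ∈ Icc a b, g x = g y → x = y ∨ (x = a ∧ y = b) ∨ (x = b ∧ y = a)) :
    False := by
  have mono : ∀ x y, a ≤ x → x < y → y ≤ b → (a < x ∨ y < b) →
      StrictMonoOn g (Icc x y) ∨ StrictAntiOn g (Icc x y) := by
    intro x y h1 h2 h3 h4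
    have hs : Icc x y ⊆ Icc a b := Icc_subset_Icc h1 h3
    refine (hg.mono hs).strictMonoOn_of_injOn_Icc' h2.le ?_
    intro u hu v hv huv
    rcases inj u (hs hu) v (hs hv) huv with h | ⟨h5, h6⟩ | ⟨h5, h6⟩
    · exact h
    · rcases h4 with h4 | h4
      · linarith [hu.1]
      · linarith [hv.2]
    · rcases h4 with h4 | h4
      · linarith [hv.1]
      · linarith [hu.2]
  obtain ⟨d, hd, hb⟩ : ∃ d, 0 < d ∧ b = a + 3 * d := ⟨(b - a) / 3, by linarith, by ring⟩
  have m1 := mono a (a + 2 * d) le_rfl (by linarith) (by linarith) (Or.inr (by linarith))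
  have m2 := mono (a + d) b (by linarith) (by linarith) le_rfl (Or.inl (by linarith))
  have i1 : a ∈ Icc a (a + 2 * d) := ⟨by linarith, by linarith⟩
  have i2 : a + d ∈ Icc a (a + 2 * d) := ⟨by linarith, by linarith⟩
  have i3 : a + 2 * d ∈ Icc a (a + 2 * d) := ⟨by linarith, by linarith⟩
  have k2 : a + d ∈ Icc (a + d) b := ⟨by linarith, by linarith⟩
  have k3 : a + 2 * d ∈ Icc (a + d) b := ⟨by linarith, by linarith⟩
  have k4 : b ∈ Icc (a + d) b := ⟨by linarith, by linarith⟩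
  have l1 : a < a + d := by linarith
  have l2 : a + d < a + 2 * d := by linarith
  have l3 : a + 2 * d < b := by linarith
  rcases m1 with m1 | m1 <;> rcases m2 with m2 | m2 <;>
    linarith [m1 i1 i2 l1, m1 i2 i3 l2, m2 k2 k3 l2, m2 k3 k4 l3]

/-- Weak Jordan Theorem: the complement of a circuit is disconnected. -/
theorem weak_jordan (f : ℝ → ℝ × ℝ) (a b : ℝ) (hf : IsCircuit f a b) :
    ¬ IsPreconnected ((f '' Set.Icc a b)ᶜ) := by
  obtain ⟨hab, hcont, hcirc⟩ := hf
  have ha : a ∈ Icc a b := ⟨le_rfl, hab.le⟩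
  have hb : b ∈ Icc a b := ⟨hab.le, le_rfl⟩
  have hfab : f a = f b := (hcirc a ha b hb hab.ne).2 rfl
  have inj : ∀ x ∈ Icc a b, ∀ y ∈ Icc a b, f x = f y →
      x = y ∨ (x = a ∧ y = b) ∨ (x = b ∧ y = a) := by
    intro x hx y hy h
    by_cases hxy : x = y
    · exact Or.inl hxy
    · exact Or.inr (Set.pair_eq_pair_iff.1 ((hcirc x hx y hy hxy).1 h))
  have c1 : ContinuousOn (fun x => (f x).1) (Icc a b) := continuous_fst.comp_continuousOn hcont
  have c2 : ContinuousOn (fun x => (f x).2) (Icc a b) := continuous_snd.comp_continuousOn hcont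
  obtain ⟨u, hu, hu'⟩ := isCompact_Icc.exists_isMinOn ⟨a, ha⟩ c1
  obtain ⟨v, hv, hv'⟩ := isCompact_Icc.exists_isMaxOn ⟨a, ha⟩ c1
  have hx : ∀ x ∈ Icc a b, (f u).1 ≤ (f x).1 ∧ (f x).1 ≤ (f v).1 := fun x hx => ⟨hu' hx, hv' hx⟩
  have hlt : (f u).1 < (f v).1 := by
    rcases (hx u hu).2.lt_or_eq with h | h
    · exact h
    · exfalso
      refine wj_no_inj (fun x => (f x).2) a b hab c2 (by simp [hfab]) fun x hx1 y hy1 hxy => ?_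
      refine inj x hx1 y hy1 (Prod.ext ?_ hxy)
      have := hx x hx1
      have := hx y hy1
      linarith
  rcases lt_trichotomy u v with h | h | h
  · exact wj_final2 f a b u v _ _ hcont hfab inj hu.1 h hv.2 (Or.inl ⟨rfl, rfl⟩) hlt hx
  · rw [h] at hlt; exact absurd hlt (lt_irrefl _)
  · exact wj_final2 f a b v u _ _ hcont hfab inj hv.1 h hu.2 (Or.inr ⟨rfl, rfl⟩) hlt hx
end

section
/- For any piecewise-linear circuit f : I → ℝ², the complement ℝ² \ f(I) is the disjoint union of two nonempty open connected sets. -/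
/-- A PL map on `[a,b]`: affine and nonconstant on each piece of a finite
partition of `[a,b]`. -/
def IsPLMap (f : ℝ → ℝ × ℝ) (a b : ℝ) : Prop :=
  ∃ (k : ℕ) (t : ℕ → ℝ), 0 < k ∧ t 0 = a ∧ t k = b ∧
    (∀ i < k, t i < t (i + 1)) ∧
    ∀ i < k, ∃ u v : ℝ × ℝ, v ≠ 0 ∧
      ∀ x ∈ Set.Icc (t i) (t (i + 1)), f x = u + x • v

/-- A PL circuit: a PL map on `[a,b]` that is injective except `f a = f b`. -/
def IsPLCircuit (f : ℝ → ℝ × ℝ) (a b : ℝ) : Prop :=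
  IsPLMap f a b ∧ a < b ∧
    ∀ x ∈ Set.Icc a b, ∀ y ∈ Set.Icc a b, x ≠ y →
      (f x = f y ↔ ({x, y} : Set ℝ) = {a, b})

namespace PLJordanAux

open Set Topology Filter

theorem aux_polar (z : ℂ) : ∃ θ : ℝ, 0 ≤ θ ∧ θ < 2 * Real.pi ∧
    z = (‖z‖ : ℂ) * Complex.exp (θ * Complex.I) := by
  have hpi := Real.pi_pos
  by_cases h : 0 ≤ z.arg
  · exact ⟨z.arg, h, by linarith [Complex.arg_le_pi z], (Complex.norm_mul_exp_arg_mul_I z).symm⟩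
  · refine ⟨z.arg + 2 * Real.pi, by linarith [Complex.neg_pi_lt_arg z], by linarith, ?_⟩
    have := (Complex.norm_mul_exp_arg_mul_I z).symm
    rw [show (((z.arg + 2 * Real.pi : ℝ) : ℂ) * Complex.I)
      = z.arg * Complex.I + 2 * Real.pi * Complex.I by push_cast; ring,
      Complex.exp_add, Complex.exp_two_pi_mul_I, mul_one]
    exact this

theorem aux_polar_unique {ρ τ θ θ' : ℝ} (hρ : 0 < ρ) (hτ : 0 ≤ τ) (h0 : 0 ≤ θ)
    (h1 : θ < 2 * Real.pi) (h0' : 0 ≤ θ') (h1' : θ' < 2 * Real.pi)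
    (h : (ρ : ℂ) * Complex.exp (θ * Complex.I) = τ * Complex.exp (θ' * Complex.I)) :
    θ = θ' := by
  have hn := congrArg norm h
  simp only [norm_mul, Complex.norm_real, Complex.norm_exp_ofReal_mul_I, mul_one,
    Real.norm_eq_abs, abs_of_pos hρ, abs_of_nonneg hτ] at hn
  subst hn
  have h2 := mul_left_cancel₀ (by exact_mod_cast hρ.ne') h
  rw [Complex.exp_eq_exp_iff_exists_int] at h2
  obtain ⟨n, hn⟩ := h2
  have h3 : θ = θ' + n * (2 * Real.pi) := by
    have h4 : (θ : ℂ) * Complex.I = ((θ' + n * (2 * Real.pi) : ℝ) : ℂ) * Complex.I := by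
      rw [hn]; push_cast; ring
    exact_mod_cast mul_right_cancel₀ Complex.I_ne_zero h4
  have hpi := Real.pi_pos
  have hn0 : n = 0 := by
    have a1 : (n : ℝ) < 1 := by
      by_contra hc; push Not at hc; nlinarith
    have a2 : (-1 : ℝ) < n := by
      by_contra hc; push Not at hc; nlinarith
    have a1' : n < 1 := by exact_mod_cast a1
    have a2' : -1 < n := by exact_mod_cast a2
    omega
  simpa [hn0] using h3

theorem aux_local (C K : Set ℂ) (q u v : ℂ) (δ : ℝ) (hδ : 0 < δ) (hu : u ≠ 0) (hv : v ≠ 0)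
    (hK : IsClosed K) (hqK : q ∉ K)
    (hC : C = K ∪ ((fun τ : ℝ => q + τ * u) '' Icc 0 δ ∪ (fun τ : ℝ => q + τ * v) '' Icc 0 δ)) :
    ∃ V ∈ 𝓝 q, ∃ P₁ P₂ : Set ℂ, IsPreconnected P₁ ∧ IsPreconnected P₂ ∧
      P₁ ⊆ Cᶜ ∧ P₂ ⊆ Cᶜ ∧ V \ C ⊆ P₁ ∪ P₂ := by
  obtain ⟨r₀, hr₀, hb⟩ := Metric.isOpen_iff.1 hK.isOpen_compl q hqK
  have hu' : 0 < ‖u‖ := norm_pos_iff.2 hu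
  have hv' : 0 < ‖v‖ := norm_pos_iff.2 hv
  have huc : (‖u‖ : ℂ) ≠ 0 := by exact_mod_cast hu'.ne'
  have hvc : (‖v‖ : ℂ) ≠ 0 := by exact_mod_cast hv'.ne'
  set r := min r₀ (min (δ * ‖u‖) (δ * ‖v‖)) with hr
  have hrpos : 0 < r := by simp only [hr, lt_min_iff]; exact ⟨hr₀, by positivity, by positivity⟩
  have hr1 : r ≤ r₀ := min_le_left _ _
  have hr2 : r ≤ δ * ‖u‖ := (min_le_right _ _).trans (min_le_left _ _)
  have hr3 : r ≤ δ * ‖v‖ := (min_le_right _ _).trans (min_le_right _ _)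
  set e : ℂ := u / ‖u‖ with he
  have hen : ‖e‖ = 1 := by simp [he, hu'.ne']
  have he0 : e ≠ 0 := by intro h; simp [h] at hen
  have hue : u = ‖u‖ * e := by rw [he]; field_simp
  obtain ⟨θ₀, h0, h1, hθ⟩ := aux_polar (v / e)
  have hve : v = ‖v‖ * e * Complex.exp (θ₀ * Complex.I) := by
    rw [norm_div, hen, div_one] at hθ
    rw [div_eq_iff he0] at hθ
    rw [hθ]; simp [hen]; ring
  have hpi := Real.pi_pos
  let F : ℝ × ℝ → ℂ := fun p => q + p.1 * e * Complex.exp (p.2 * Complex.I)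
  have hF : Continuous F := by fun_prop
  have key : ∀ ρ θ : ℝ, 0 < ρ → ρ < r → 0 ≤ θ → θ < 2 * Real.pi → θ ≠ 0 → θ ≠ θ₀ →
      F (ρ, θ) ∉ C := by
    intro ρ θ hρ hρr ht0 ht1 hne0 hne hmem
    rw [hC] at hmem
    rcases hmem with h | ⟨τ, hτ, h⟩ | ⟨τ, hτ, h⟩
    · refine hb ?_ h
      simp only [Metric.mem_ball, dist_eq_norm, F, add_sub_cancel_left, norm_mul, hen,
        Complex.norm_exp_ofReal_mul_I, Complex.norm_real, Real.norm_eq_abs, abs_of_pos hρ]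
      linarith
    · apply hne0
      refine aux_polar_unique (τ := τ * ‖u‖) (θ' := 0) hρ (mul_nonneg hτ.1 hu'.le) ht0 ht1
        le_rfl (by linarith) ?_
      have h5 : (τ : ℂ) * u = ρ * e * Complex.exp (θ * Complex.I) := by simpa [F] using h
      apply mul_left_cancel₀ he0
      rw [hue] at h5
      push_cast
      simp only [zero_mul, Complex.exp_zero, mul_one]
      linear_combination -h5
    · apply hne
      refine aux_polar_unique (τ := τ * ‖v‖) hρ (mul_nonneg hτ.1 hv'.le) ht0 ht1
        h0 h1 ?_
      have h5 : (τ : ℂ) * v = ρ * e * Complex.exp (θ * Complex.I) := by simpa [F] using h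
      apply mul_left_cancel₀ he0
      have h6 := hve
      push_cast
      linear_combination -h5 + τ * h6
  refine ⟨Metric.ball q r, Metric.ball_mem_nhds q hrpos, F '' (Ioo 0 r ×ˢ Ioo 0 θ₀),
    F '' (Ioo 0 r ×ˢ Ioo θ₀ (2 * Real.pi)), ?_, ?_, ?_, ?_, ?_⟩
  · exact (isPreconnected_Ioo.prod isPreconnected_Ioo).image _ hF.continuousOn
  · exact (isPreconnected_Ioo.prod isPreconnected_Ioo).image _ hF.continuousOn
  · rintro _ ⟨⟨ρ, θ⟩, ⟨⟨a1, a2⟩, ⟨a3, a4⟩⟩, rfl⟩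
    simp only at a1 a2 a3 a4
    exact key ρ θ a1 a2 a3.le (by linarith) a3.ne' a4.ne
  · rintro _ ⟨⟨ρ, θ⟩, ⟨⟨a1, a2⟩, ⟨a3, a4⟩⟩, rfl⟩
    simp only at a1 a2 a3 a4
    exact key ρ θ a1 a2 (by linarith) (by linarith) (by linarith) a3.ne'
  · rintro z ⟨hz, hzC⟩
    obtain ⟨θ, ht0, ht1, hθz⟩ := aux_polar ((z - q) / e)
    rw [norm_div, hen, div_one, div_eq_iff he0] at hθz
    have hzr : ‖z - q‖ < r := by simpa [dist_eq_norm] using hz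
    have hzF : F (‖z - q‖, θ) = z := by
      simp only [F]; linear_combination -hθz
    have hzn : z ≠ q := by
      rintro rfl
      apply hzC; rw [hC]; right; left; exact ⟨0, ⟨le_rfl, hδ.le⟩, by simp⟩
    have hzp : 0 < ‖z - q‖ := norm_pos_iff.2 (sub_ne_zero.2 hzn)
    have hne0 : θ ≠ 0 := by
      rintro rfl
      apply hzC; rw [hC]; right; left
      refine ⟨‖z - q‖ / ‖u‖, ⟨by positivity, ?_⟩, ?_⟩
      · rw [div_le_iff₀ hu']; linarith
      · simp only
        rw [← hzF]; simp only [F]; rw [he]; push_cast; simp; field_simp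
    have hne : θ ≠ θ₀ := by
      rintro rfl
      apply hzC; rw [hC]; right; right
      refine ⟨‖z - q‖ / ‖v‖, ⟨by positivity, ?_⟩, ?_⟩
      · rw [div_le_iff₀ hv']; linarith
      · simp only
        have : ((‖z - q‖ / ‖v‖ : ℝ) : ℂ) * v = ‖z - q‖ * e * Complex.exp (θ * Complex.I) := by
          push_cast
          rw [div_mul_eq_mul_div, div_eq_iff hvc]
          linear_combination (‖z - q‖ : ℂ) * hve
        rw [this]; exact hzF
    rcases lt_or_gt_of_ne hne with h | h
    · left; exact ⟨(‖z - q‖, θ), ⟨⟨hzp, hzr⟩, ⟨lt_of_le_of_ne ht0 hne0.symm, h⟩⟩, hzF⟩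
    · right; exact ⟨(‖z - q‖, θ), ⟨⟨hzp, hzr⟩, ⟨h, ht1⟩⟩, hzF⟩

theorem aux_top (C : Set ℂ) (W : ℂ → ℂ) (hCc : IsClosed C) (hCp : IsPreconnected C)
    (hCn : C.Nonempty)
    (hW : ∀ S ⊆ Cᶜ, IsPreconnected S → ∀ y ∈ S, ∀ y' ∈ S, W y = W y')
    (hj : ∀ q ∈ C, ∀ N ∈ 𝓝 q, ∃ y ∈ N \ C, ∃ y' ∈ N \ C, W y ≠ W y')
    (hl : ∀ q ∈ C, ∃ V ∈ 𝓝 q, ∃ P₁ P₂ : Set ℂ, IsPreconnected P₁ ∧ IsPreconnected P₂ ∧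
      P₁ ⊆ Cᶜ ∧ P₂ ⊆ Cᶜ ∧ V \ C ⊆ P₁ ∪ P₂) :
    ∃ A B : Set ℂ, IsOpen A ∧ IsOpen B ∧ IsConnected A ∧ IsConnected B ∧ Disjoint A B ∧
      A ∪ B = Cᶜ := by
  have hU : IsOpen Cᶜ := hCc.isOpen_compl
  let cc := fun x => connectedComponentIn Cᶜ x
  have hop : ∀ x, IsOpen (cc x) := fun x => hU.connectedComponentIn
  have hsub : ∀ x, cc x ⊆ Cᶜ := fun x => connectedComponentIn_subset _ _
  have hpre : ∀ x, IsPreconnected (cc x) := fun x => isPreconnected_connectedComponentIn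
  have hself : ∀ x, x ∉ C → x ∈ cc x := fun x hx => mem_connectedComponentIn hx
  have hP : ∀ P : Set ℂ, IsPreconnected P → P ⊆ Cᶜ → ∀ x, ∀ z ∈ P, ∀ y ∈ P, z ∈ cc x → y ∈ cc x := by
    intro P hP hPC x z hz y hy hzx
    have h1 : cc x = cc z := connectedComponentIn_eq hzx
    rw [h1]
    exact hP.subset_connectedComponentIn hz hPC hy
  have h3 : ∀ P₁ P₂ : Set ℂ, IsPreconnected P₁ → IsPreconnected P₂ → P₁ ⊆ Cᶜ → P₂ ⊆ Cᶜ →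
      ∀ x z y y', z ∈ P₁ ∪ P₂ → y ∈ P₁ ∪ P₂ → y' ∈ P₁ ∪ P₂ → W y ≠ W y' → z ∈ cc x →
      y ∈ cc x ∨ y' ∈ cc x := by
    intro P₁ P₂ p1 p2 s1 s2 x z y y' hz hy hy' hne hzx
    have e1 := hP P₁ p1 s1 x z
    have e2 := hP P₂ p2 s2 x z
    have n1 := hW P₁ s1 p1 y
    have n2 := hW P₂ s2 p2 y
    rcases hz with hz | hz <;> rcases hy with hy | hy <;> rcases hy' with hy' | hy' <;> grind
  have htouch : ∀ x, x ∉ C → (C ∩ closure (cc x)).Nonempty := by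
    intro x hx
    by_contra hc
    rw [not_nonempty_iff_eq_empty] at hc
    have hcl : IsClosed (cc x) := by
      rw [← closure_subset_iff_isClosed]
      intro q hq
      have hqC : q ∉ C := fun h => by
        have : q ∈ C ∩ closure (cc x) := ⟨h, hq⟩
        rw [hc] at this; exact this
      obtain ⟨z, hz1, hz2⟩ := mem_closure_iff.1 hq (cc q) (hop q) (hself q hqC)
      have h1 : cc q = cc z := connectedComponentIn_eq hz1
      have h2 : cc x = cc z := connectedComponentIn_eq hz2
      rw [h2, ← h1]; exact hself q hqC
    have huniv := IsClopen.eq_univ ⟨hcl, hop x⟩ ⟨x, hself x hx⟩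
    obtain ⟨q, hq⟩ := hCn
    exact hsub x (huniv ▸ mem_univ q) hq
  have hall : ∀ x, x ∉ C → C ⊆ closure (cc x) := by
    intro x hx
    have hopen : ∀ q ∈ C ∩ closure (cc x), ∃ V, IsOpen V ∧ q ∈ V ∧ C ∩ V ⊆ closure (cc x) := by
      rintro q ⟨hqC, hq⟩
      obtain ⟨V, hV, P₁, P₂, p1, p2, s1, s2, hcov⟩ := hl q hqC
      obtain ⟨V', hV'V, hV'o, hqV'⟩ := mem_nhds_iff.1 hV
      refine ⟨V', hV'o, hqV', ?_⟩
      rintro q' ⟨hq'C, hq'V⟩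
      obtain ⟨z, hz1, hz2⟩ := mem_closure_iff.1 hq V' hV'o hqV'
      rw [mem_closure_iff_nhds]
      intro N hN
      obtain ⟨y, hy, y', hy', hne⟩ := hj q' hq'C (N ∩ V') (inter_mem hN (hV'o.mem_nhds hq'V))
      rcases h3 P₁ P₂ p1 p2 s1 s2 x z y y' (hcov ⟨hV'V hz1, hsub x hz2⟩)
        (hcov ⟨hV'V hy.1.2, hy.2⟩) (hcov ⟨hV'V hy'.1.2, hy'.2⟩) hne hz2 with h | h
      · exact ⟨y, hy.1.1, h⟩
      · exact ⟨y', hy'.1.1, h⟩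
    choose! V hV1 hV2 hV3 using hopen
    by_contra hc
    obtain ⟨q₁, hq₁, hq₁'⟩ := not_subset.1 hc
    obtain ⟨q, hq⟩ := htouch x hx
    obtain ⟨w, hwC, hw1, hw2⟩ := hCp (⋃ q ∈ C ∩ closure (cc x), V q) (closure (cc x))ᶜ
      (isOpen_biUnion fun q hq => hV1 q hq) isClosed_closure.isOpen_compl
      (by
        intro w hw
        by_cases h : w ∈ closure (cc x)
        · left; exact mem_biUnion (⟨hw, h⟩ : w ∈ C ∩ closure (cc x)) (hV2 w ⟨hw, h⟩)
        · right; exact h)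
      ⟨q, hq.1, mem_biUnion hq (hV2 q hq)⟩ ⟨q₁, hq₁, hq₁'⟩
    obtain ⟨q', hq', hwq⟩ := mem_iUnion₂.1 hw1
    exact hw2 (hV3 q' hq' ⟨hwC, hwq⟩)
  obtain ⟨q, hq⟩ := hCn
  obtain ⟨V, hV, P₁, P₂, p1, p2, s1, s2, hcov⟩ := hl q hq
  obtain ⟨y, hy, y', hy', hne⟩ := hj q hq V hV
  refine ⟨cc y, cc y', hop y, hop y', ⟨⟨y, hself y hy.2⟩, hpre y⟩, ⟨⟨y', hself y' hy'.2⟩, hpre y'⟩,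
    ?_, ?_⟩
  · rw [disjoint_left]
    intro z hz hz'
    have h1 : cc y = cc z := connectedComponentIn_eq hz
    have h2 : cc y' = cc z := connectedComponentIn_eq hz'
    refine hne (hW (cc y) (hsub y) (hpre y) y (hself y hy.2) y' ?_)
    rw [h1, ← h2]; exact hself y' hy'.2
  · apply Subset.antisymm (union_subset (hsub y) (hsub y'))
    intro x hx
    obtain ⟨z, hz1, hz2⟩ := mem_closure_iff_nhds.1 (hall x hx hq) V hV
    rcases h3 P₁ P₂ p1 p2 s1 s2 x z y y' (hcov ⟨hz1, hsub x hz2⟩) (hcov hy) (hcov hy') hne hz2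
      with h | h
    · left
      have h1 : cc x = cc y := connectedComponentIn_eq h
      rw [← h1]; exact hself x hx
    · right
      have h1 : cc x = cc y' := connectedComponentIn_eq h
      rw [← h1]; exact hself x hx

theorem aux_cover_right (t : ℕ → ℝ) (n : ℕ) : ∀ x ∈ Ico (t 0) (t n),
    ∃ i < n, x ∈ Ico (t i) (t (i + 1)) := by
  induction n with
  | zero => intro x hx; exact absurd (hx.1.trans_lt hx.2) (lt_irrefl _)
  | succ n ih =>
    intro x hx
    by_cases h : x < t n
    · obtain ⟨i, hi, hxi⟩ := ih x ⟨hx.1, h⟩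
      exact ⟨i, by omega, hxi⟩
    · exact ⟨n, by omega, not_lt.1 h, hx.2⟩

theorem aux_cover_left (t : ℕ → ℝ) (n : ℕ) : ∀ x ∈ Ioc (t 0) (t n),
    ∃ i < n, x ∈ Ioc (t i) (t (i + 1)) := by
  induction n with
  | zero => intro x hx; exact absurd (hx.1.trans_le hx.2) (lt_irrefl _)
  | succ n ih =>
    intro x hx
    by_cases h : x ≤ t n
    · obtain ⟨i, hi, hxi⟩ := ih x ⟨hx.1, h⟩
      exact ⟨i, by omega, hxi⟩
    · exact ⟨n, by omega, not_le.1 h, hx.2⟩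

theorem aux_mono (t : ℕ → ℝ) (k : ℕ) (ht : ∀ i < k, t i < t (i + 1)) (i j : ℕ) (hij : i ≤ j)
    (hj : j ≤ k) : t i ≤ t j := by
  induction j, hij using Nat.le_induction with
  | base => exact le_rfl
  | succ j hij ih => exact (ih (by omega)).trans (ht j (by omega)).le

theorem aux_cont (g : ℝ → ℂ) (t : ℕ → ℝ) (k : ℕ) (ht : ∀ i < k, t i < t (i + 1))
    (hg : ∀ i < k, ∃ u v : ℂ, v ≠ 0 ∧ ∀ x ∈ Icc (t i) (t (i + 1)), g x = u + x * v)
    (n : ℕ) (hn : n ≤ k) : ContinuousOn g (Icc (t 0) (t n)) := by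
  induction n with
  | zero => simp
  | succ n ih =>
    rw [← Icc_union_Icc_eq_Icc (aux_mono t k ht 0 n (by omega) (by omega)) (ht n (by omega)).le]
    refine ContinuousOn.union_of_isClosed (ih (by omega)) ?_ isClosed_Icc isClosed_Icc
    obtain ⟨u, v, -, h⟩ := hg n (by omega)
    exact ContinuousOn.congr (by fun_prop) h

theorem aux_log_cont (A B p : ℂ) (h : ∀ s ∈ Icc (0 : ℝ) 1, p ≠ A + s * (B - A)) :
    ContinuousAt (fun p => Complex.log ((B - p) / (A - p))) p := by
  have hA : A - p ≠ 0 := by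
    intro h0; apply h 0 (by simp); simp; linear_combination -h0
  refine ContinuousAt.clog (by fun_prop (disch := exact hA)) ?_
  by_contra hs
  rw [Complex.mem_slitPlane_iff_not_le_zero, not_not, Complex.le_def] at hs
  set w := (B - p) / (A - p) with hw
  obtain ⟨c, hc⟩ : ∃ c : ℝ, c = -w.re := ⟨_, rfl⟩
  have hc0 : 0 ≤ c := by have := hs.1; simp at this; linarith
  have hwc : w = -(c : ℂ) := by
    apply Complex.ext
    · simp [hc]
    · simpa using hs.2
  have hB : B - p = -c * (A - p) := by rw [← hwc, hw]; field_simp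
  have h1c : (1 + c : ℂ) ≠ 0 := by exact_mod_cast (by positivity : (1 + c : ℝ) ≠ 0)
  apply h (1 / (1 + c)) ⟨by positivity, by rw [div_le_one (by positivity)]; linarith⟩
  push_cast
  field_simp
  linear_combination -hB

theorem aux_log_jump (A B : ℂ) (hAB : A ≠ B) (s : ℝ) (hs0 : 0 < s) (hs1 : s < 1) :
    ∃ l : ℂ,
    Tendsto (fun ε : ℝ => Complex.log ((B - (A + s * (B - A) + ε * Complex.I * (B - A))) /
      (A - (A + s * (B - A) + ε * Complex.I * (B - A))))) (𝓝[>] 0) (𝓝 (l + Real.pi * Complex.I)) ∧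
    Tendsto (fun ε : ℝ => Complex.log ((B - (A + s * (B - A) + (-ε : ℝ) * Complex.I * (B - A))) /
      (A - (A + s * (B - A) + (-ε : ℝ) * Complex.I * (B - A))))) (𝓝[>] 0)
      (𝓝 (l - Real.pi * Complex.I)) := by
  have hD : B - A ≠ 0 := sub_ne_zero.2 hAB.symm
  have hsc : (s : ℂ) ≠ 0 := by exact_mod_cast hs0.ne'
  have hne : ∀ ε : ℝ, (s : ℂ) + ε * Complex.I ≠ 0 := by
    intro ε h
    have := congrArg Complex.re h
    simp at this; linarith
  let z : ℝ → ℂ := fun ε => ((s : ℂ) - 1 + ε * Complex.I) / (s + ε * Complex.I)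
  have hz : ∀ ε : ℝ, (B - (A + s * (B - A) + ε * Complex.I * (B - A))) /
      (A - (A + s * (B - A) + ε * Complex.I * (B - A))) = z ε := by
    intro ε
    have h1 := hne ε
    have h2 : A - (A + s * (B - A) + ε * Complex.I * (B - A)) ≠ 0 := by
      rw [show A - (A + s * (B - A) + ε * Complex.I * (B - A))
        = -((s + ε * Complex.I) * (B - A)) by ring]
      exact neg_ne_zero.2 (mul_ne_zero h1 hD)
    simp only [z]
    rw [div_eq_div_iff h2 h1]; ring
  have him : ∀ ε : ℝ, (z ε).im = ε / (s ^ 2 + ε ^ 2) := by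
    intro ε
    have : s ^ 2 + ε ^ 2 ≠ 0 := by positivity
    simp [z, Complex.div_im, Complex.normSq_apply]
    field_simp
    ring
  have hzc : Continuous z := by
    simp only [z]
    exact Continuous.div (by fun_prop) (by fun_prop) hne
  have hz0 : z 0 = (((s - 1) / s : ℝ) : ℂ) := by simp [z]
  have hre : (z 0).re < 0 := by
    rw [hz0, Complex.ofReal_re]; exact div_neg_of_neg_of_pos (by linarith) hs0
  have him0 : (z 0).im = 0 := by rw [hz0, Complex.ofReal_im]
  refine ⟨Real.log ‖z 0‖, ?_, ?_⟩
  · simp only [hz]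
    refine (Complex.tendsto_log_nhdsWithin_im_nonneg_of_re_neg_of_im_zero hre him0).comp ?_
    refine tendsto_nhdsWithin_iff.2 ⟨hzc.continuousAt.tendsto.mono_left nhdsWithin_le_nhds, ?_⟩
    filter_upwards [self_mem_nhdsWithin] with ε hε
    have : 0 < ε := hε
    simp only [him]; positivity
  · simp only [hz]
    refine (Complex.tendsto_log_nhdsWithin_im_neg_of_re_neg_of_im_zero hre him0).comp ?_
    refine tendsto_nhdsWithin_iff.2 ⟨?_, ?_⟩
    · have : Tendsto (fun ε : ℝ => z (-ε)) (𝓝 0) (𝓝 (z (-0))) :=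
        (hzc.comp continuous_neg).continuousAt.tendsto
      rw [neg_zero] at this
      exact this.mono_left nhdsWithin_le_nhds
    · filter_upwards [self_mem_nhdsWithin] with ε hε
      have : 0 < ε := hε
      simp only [him]
      exact div_neg_of_neg_of_pos (by linarith) (by positivity)

theorem aux_main (g : ℝ → ℂ) (t : ℕ → ℝ) (k : ℕ) (hk : 0 < k) (ht : ∀ i < k, t i < t (i + 1))
    (hg : ∀ i < k, ∃ u v : ℂ, v ≠ 0 ∧ ∀ x ∈ Icc (t i) (t (i + 1)), g x = u + x * v)
    (hab : t 0 < t k)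
    (hinj : ∀ x ∈ Icc (t 0) (t k), ∀ y ∈ Icc (t 0) (t k), x ≠ y →
      (g x = g y ↔ ({x, y} : Set ℝ) = {t 0, t k})) :
    ∃ A B : Set ℂ, IsOpen A ∧ IsOpen B ∧ IsConnected A ∧ IsConnected B ∧ Disjoint A B ∧
      A ∪ B = (g '' Icc (t 0) (t k))ᶜ := by
  have hcont : ContinuousOn g (Icc (t 0) (t k)) := aux_cont g t k ht hg k le_rfl
  have hmono := aux_mono t k ht
  have hends : g (t 0) = g (t k) :=
    (hinj _ (left_mem_Icc.2 hab.le) _ (right_mem_Icc.2 hab.le) hab.ne).2 rfl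
  have hint : ∀ s ∈ Ioo (t 0) (t k), ∀ x ∈ Icc (t 0) (t k), g x = g s → x = s := by
    intro s hs x hx h
    by_contra hne
    have h1 := (hinj x hx s (Ioo_subset_Icc_self hs) hne).1 h
    have h2 : s ∈ ({t 0, t k} : Set ℝ) := by rw [← h1]; simp
    rcases h2 with h2 | h2
    · exact hs.1.ne' h2
    · exact hs.2.ne h2
  have hint0 : ∀ x ∈ Ioo (t 0) (t k), g x ≠ g (t 0) := by
    intro x hx h
    have := hint x hx (t 0) (left_mem_Icc.2 hab.le) h.symm
    exact hx.1.ne this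
  have hsubE : ∀ i < k, Icc (t i) (t (i + 1)) ⊆ Icc (t 0) (t k) := fun i hi =>
    Icc_subset_Icc (hmono 0 i (by omega) (by omega)) (hmono (i + 1) k (by omega) le_rfl)
  have hseg : ∀ i < k, ∀ s ∈ Icc (0 : ℝ) 1, t i + s * (t (i + 1) - t i) ∈ Icc (t i) (t (i + 1)) ∧
      g (t i + s * (t (i + 1) - t i)) = g (t i) + s * (g (t (i + 1)) - g (t i)) := by
    intro i hi s hs
    have hti := ht i hi
    have hm : t i + s * (t (i + 1) - t i) ∈ Icc (t i) (t (i + 1)) := by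
      constructor <;> nlinarith [hs.1, hs.2]
    refine ⟨hm, ?_⟩
    obtain ⟨u, v, -, h⟩ := hg i hi
    rw [h _ hm, h _ (left_mem_Icc.2 hti.le), h _ (right_mem_Icc.2 hti.le)]
    push_cast; ring
  have hcomp : ∀ i < k, IsCompact (g '' Icc (t i) (t (i + 1))) := fun i hi =>
    isCompact_Icc.image_of_continuousOn (hcont.mono (hsubE i hi))
  have hCE : ∀ z ∈ g '' Icc (t 0) (t k), ∃ i < k, z ∈ g '' Icc (t i) (t (i + 1)) := by
    rintro _ ⟨x, hx, rfl⟩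
    rcases hx.2.eq_or_lt with h | h
    · refine ⟨k - 1, by omega, x, ?_, rfl⟩
      rw [h, show k - 1 + 1 = k by omega]
      exact right_mem_Icc.2 (hmono _ _ (by omega) le_rfl)
    · obtain ⟨i, hi, hxi⟩ := aux_cover_right t k x ⟨hx.1, h⟩
      exact ⟨i, hi, x, Ico_subset_Icc_self hxi, rfl⟩
  let L : ℕ → ℂ → ℂ := fun j p => Complex.log ((g (t (j + 1)) - p) / (g (t j) - p))
  have hL : ∀ j < k, ∀ p, p ∉ g '' Icc (t j) (t (j + 1)) → ContinuousAt (L j) p := by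
    intro j hj p hp
    refine aux_log_cont _ _ p ?_
    intro s hs h
    obtain ⟨h1, h2⟩ := hseg j hj s hs
    exact hp ⟨_, h1, by rw [h2, h]⟩
  let W : ℂ → ℂ := fun p => ∑ j ∈ Finset.range k, L j p
  refine aux_top (g '' Icc (t 0) (t k)) W (isCompact_Icc.image_of_continuousOn hcont).isClosed
    (isPreconnected_Icc.image _ hcont) ⟨_, _, left_mem_Icc.2 hab.le, rfl⟩ ?_ ?_ ?_
  · skip
    intro S hSC hS y hy y' hy'
    have hWc : ContinuousOn W S := by
      intro p hp
      refine ContinuousAt.continuousWithinAt ?_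
      refine tendsto_finsetSum _ fun j hj => ?_
      rw [Finset.mem_range] at hj
      exact hL j hj p fun h => hSC hp (image_mono (hsubE j hj) h)
    have hWr : W '' S ⊆ range (fun n : ℤ => (n : ℂ) * (2 * Real.pi * Complex.I)) := by
      rintro _ ⟨p, hp, rfl⟩
      have hp0 : ∀ j ≤ k, g (t j) - p ≠ 0 := by
        intro j hj h
        exact hSC hp ⟨t j, ⟨hmono 0 j (by omega) hj, hmono j k hj le_rfl⟩, sub_eq_zero.1 h⟩
      have h1 : Complex.exp (W p) = 1 := by
        have h2 : ∀ n ≤ k, Complex.exp (∑ j ∈ Finset.range n, L j p)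
            = (g (t n) - p) / (g (t 0) - p) := by
          intro n
          induction n with
          | zero => intro _; simp [div_self (hp0 0 (by omega))]
          | succ n ih =>
            intro hn
            have e1 := hp0 n (by omega)
            have e2 := hp0 0 (by omega)
            have e3 := hp0 (n + 1) hn
            rw [Finset.sum_range_succ, Complex.exp_add, ih (by omega),
              Complex.exp_log (div_ne_zero e3 e1)]
            field_simp
        have := h2 k le_rfl
        rw [← hends, div_self (hp0 0 (by omega))] at this
        exact this
      obtain ⟨n, hn⟩ := Complex.exp_eq_one_iff.1 h1
      exact ⟨n, hn.symm⟩
    exact (countable_range _).isTotallyDisconnected _ hWr (hS.image _ hWc)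
      (mem_image_of_mem _ hy) (mem_image_of_mem _ hy')
  · skip
    have hjint : ∀ i < k, ∀ s ∈ Ioo (0 : ℝ) 1, ∀ N ∈ 𝓝 (g (t i) + s * (g (t (i + 1)) - g (t i))),
        ∃ y ∈ N \ g '' Icc (t 0) (t k), ∃ y' ∈ N \ g '' Icc (t 0) (t k), W y ≠ W y' := by
      intro i hi s hs N hN
      obtain ⟨hm, hgs⟩ := hseg i hi s (Ioo_subset_Icc_self hs)
      have hti := ht i hi
      have hm' : t i + s * (t (i + 1) - t i) ∈ Ioo (t i) (t (i + 1)) := by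
        constructor <;> nlinarith [hs.1, hs.2]
      set x := t i + s * (t (i + 1) - t i) with hx
      set p := g (t i) + s * (g (t (i + 1)) - g (t i)) with hp
      have hxI : x ∈ Ioo (t 0) (t k) := ⟨(hmono 0 i (by omega) (by omega)).trans_lt hm'.1,
        hm'.2.trans_le (hmono (i + 1) k (by omega) le_rfl)⟩
      have hAB : g (t i) ≠ g (t (i + 1)) := by
        obtain ⟨u, v, hv, h⟩ := hg i hi
        rw [h _ (left_mem_Icc.2 hti.le), h _ (right_mem_Icc.2 hti.le)]
        intro h'
        have : ((t (i + 1) - t i : ℝ) : ℂ) * v = 0 := by push_cast; linear_combination -h'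
        rcases mul_eq_zero.1 this with h'' | h''
        · have h3 : t (i + 1) - t i = 0 := by exact_mod_cast h''
          linarith
        · exact hv h''
      have hD : g (t (i + 1)) - g (t i) ≠ 0 := sub_ne_zero.2 hAB.symm
      have hoff : ∀ j < k, j ≠ i → p ∉ g '' Icc (t j) (t (j + 1)) := by
        rintro j hj hji ⟨x', hx', h⟩
        have h1 := hint x hxI x' (hsubE j hj hx') (h.trans hgs.symm)
        subst h1
        rcases lt_or_gt_of_ne hji with h2 | h2
        · linarith [hx'.2, hm'.1, hmono (j + 1) i (by omega) (by omega)]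
        · linarith [hx'.1, hm'.2, hmono (i + 1) j (by omega) (by omega)]
      obtain ⟨l, hl1, hl2⟩ := aux_log_jump _ _ hAB s hs.1 hs.2
      rw [← hp] at hl1 hl2
      let Y : ℝ → ℂ := fun ε => p + ε * Complex.I * (g (t (i + 1)) - g (t i))
      have hYc : Continuous Y := by fun_prop
      have hY0 : Y 0 = p := by simp [Y]
      have hY1 : Tendsto Y (𝓝[>] 0) (𝓝 p) := by
        have := hYc.continuousAt (x := 0) |>.tendsto
        rw [hY0] at this
        exact this.mono_left nhdsWithin_le_nhds
      have hY2 : Tendsto (fun ε => Y (-ε)) (𝓝[>] 0) (𝓝 p) := by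
        have := (hYc.comp continuous_neg).continuousAt (x := 0) |>.tendsto
        simp only [Function.comp_apply, neg_zero, hY0] at this
        exact this.mono_left nhdsWithin_le_nhds
      have hYi : ∀ ε : ℝ, ε ≠ 0 → Y ε ∉ g '' Icc (t i) (t (i + 1)) := by
        rintro ε hε ⟨x', hx', h⟩
        have hd : 0 < t (i + 1) - t i := by linarith
        obtain ⟨e1, e2⟩ := hseg i hi ((x' - t i) / (t (i + 1) - t i))
          ⟨div_nonneg (by linarith [hx'.1]) hd.le, by rw [div_le_one hd]; linarith [hx'.2]⟩
        rw [div_mul_cancel₀ _ hd.ne', add_sub_cancel, h] at e2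
        simp only [Y, hp] at e2
        have e3 : (s : ℂ) + ε * Complex.I = (((x' - t i) / (t (i + 1) - t i) : ℝ) : ℂ) := by
          apply mul_right_cancel₀ hD
          linear_combination e2
        have := congrArg Complex.im e3
        rw [Complex.ofReal_im] at this
        simp at this
        exact hε this
      have hNoff : N ∩ {z | ∀ j ∈ Finset.range k, j ≠ i → z ∉ g '' Icc (t j) (t (j + 1))} ∈ 𝓝 p := by
        refine inter_mem hN ?_
        refine (Filter.eventually_all_finset _).2 fun j hj => ?_
        rw [Finset.mem_range] at hj
        by_cases hji : j = i
        · exact Eventually.of_forall fun z h => absurd hji h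
        · filter_upwards [(hcomp j hj).isClosed.isOpen_compl.mem_nhds (hoff j hj hji)] with z hz _
          exact hz
      have hWj : Tendsto (fun ε => W (Y ε) - W (Y (-ε))) (𝓝[>] 0)
          (𝓝 (∑ j ∈ Finset.range k, if j = i then 2 * Real.pi * Complex.I else 0)) := by
        simp only [W, ← Finset.sum_sub_distrib]
        refine tendsto_finsetSum _ fun j hj => ?_
        rw [Finset.mem_range] at hj
        by_cases hji : j = i
        · subst hji
          have := hl1.sub hl2
          rw [if_pos rfl]
          convert this using 2
          ring
        · rw [if_neg hji]
          have hc := (hL j hj p (hoff j hj hji)).tendsto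
          have := (hc.comp hY1).sub (hc.comp hY2)
          rw [sub_self] at this
          exact this
      rw [Finset.sum_ite_eq' , if_pos (Finset.mem_range.2 hi)] at hWj
      have hne : (2 * Real.pi * Complex.I : ℂ) ≠ 0 := Complex.two_pi_I_ne_zero
      obtain ⟨ε, e1, e2, e3, e4⟩ := ((hWj.eventually_ne hne).and ((hY1.eventually_mem hNoff).and
        ((hY2.eventually_mem hNoff).and self_mem_nhdsWithin))).exists
      have e4' : (0 : ℝ) < ε := e4
      have hfin : ∀ ε : ℝ, ε ≠ 0 → Y ε ∈ N ∩ {z | ∀ j ∈ Finset.range k, j ≠ i →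
          z ∉ g '' Icc (t j) (t (j + 1))} → Y ε ∈ N \ g '' Icc (t 0) (t k) := by
        rintro ε hε ⟨h1, h2⟩
        refine ⟨h1, fun h => ?_⟩
        obtain ⟨j, hj, h3⟩ := hCE _ h
        by_cases hji : j = i
        · subst hji; exact hYi ε hε h3
        · exact h2 j (Finset.mem_range.2 hj) hji h3
      exact ⟨Y ε, hfin ε e4'.ne' e2, Y (-ε), hfin (-ε) (by linarith) e3, sub_ne_zero.1 e1⟩
    intro q hq N hN
    obtain ⟨i, hi, x, hx, rfl⟩ := hCE q hq
    obtain ⟨N', hN'N, hN'o, hqN'⟩ := mem_nhds_iff.1 hN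
    have hd : 0 < t (i + 1) - t i := by linarith [ht i hi]
    have hs : (x - t i) / (t (i + 1) - t i) ∈ Icc (0 : ℝ) 1 :=
      ⟨div_nonneg (by linarith [hx.1]) hd.le, by rw [div_le_one hd]; linarith [hx.2]⟩
    obtain ⟨e1, e2⟩ := hseg i hi _ hs
    rw [div_mul_cancel₀ _ hd.ne', add_sub_cancel] at e2
    have hpc : Continuous (fun s : ℝ => g (t i) + s * (g (t (i + 1)) - g (t i))) := by fun_prop
    rw [← closure_Ioo zero_ne_one] at hs
    obtain ⟨s, hs1, hs2⟩ := mem_closure_iff.1 hs _ (hN'o.preimage hpc)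
      (by rw [mem_preimage, ← e2]; exact hqN')
    obtain ⟨y, hy, y', hy', hne⟩ := hjint i hi s hs2 N' (hN'o.mem_nhds hs1)
    exact ⟨y, ⟨hN'N hy.1, hy.2⟩, y', ⟨hN'N hy'.1, hy'.2⟩, hne⟩
  · skip
    have hright : ∀ s ∈ Ico (t 0) (t k), ∃ δ > 0, s + δ ≤ t k ∧ ∃ v : ℂ, v ≠ 0 ∧
        ∀ τ ∈ Icc (0 : ℝ) δ, g (s + τ) = g s + τ * v := by
      intro s hs
      obtain ⟨i, hi, hsi⟩ := aux_cover_right t k s hs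
      obtain ⟨u, v, hv, h⟩ := hg i hi
      refine ⟨t (i + 1) - s, by linarith [hsi.2], ?_, v, hv, ?_⟩
      · linarith [hmono (i + 1) k (by omega) le_rfl]
      · intro τ hτ
        rw [h _ ⟨by linarith [hsi.1, hτ.1], by linarith [hτ.2]⟩, h _ (Ico_subset_Icc_self hsi)]
        push_cast; ring
    have hleft : ∀ s ∈ Ioc (t 0) (t k), ∃ δ > 0, t 0 ≤ s - δ ∧ ∃ v : ℂ, v ≠ 0 ∧
        ∀ τ ∈ Icc (0 : ℝ) δ, g (s - τ) = g s + τ * v := by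
      intro s hs
      obtain ⟨i, hi, hsi⟩ := aux_cover_left t k s hs
      obtain ⟨u, v, hv, h⟩ := hg i hi
      refine ⟨s - t i, by linarith [hsi.1], ?_, -v, neg_ne_zero.2 hv, ?_⟩
      · linarith [hmono 0 i (by omega) (by omega)]
      · intro τ hτ
        rw [h _ ⟨by linarith [hτ.2], by linarith [hsi.2, hτ.1]⟩, h _ (Ioc_subset_Icc_self hsi)]
        push_cast; ring
    rintro q ⟨s, hs, rfl⟩
    by_cases hsI : s ∈ Ioo (t 0) (t k)
    · obtain ⟨δ₁, hδ₁, hb₁, u, hu, h₁⟩ := hright s (Ioo_subset_Ico_self hsI)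
      obtain ⟨δ₂, hδ₂, hb₂, v, hv, h₂⟩ := hleft s (Ioo_subset_Ioc_self hsI)
      set δ := min δ₁ δ₂ with hδ
      have hd : 0 < δ := lt_min hδ₁ hδ₂
      have d1 : δ ≤ δ₁ := min_le_left _ _
      have d2 : δ ≤ δ₂ := min_le_right _ _
      have hKsub : Icc (t 0) (s - δ) ∪ Icc (s + δ) (t k) ⊆ Icc (t 0) (t k) :=
        union_subset (Icc_subset_Icc le_rfl (by linarith)) (Icc_subset_Icc (by linarith) le_rfl)
      refine aux_local _ (g '' (Icc (t 0) (s - δ) ∪ Icc (s + δ) (t k))) (g s) u v δ hd hu hv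
        ((isCompact_Icc.union isCompact_Icc).image_of_continuousOn (hcont.mono hKsub)).isClosed ?_ ?_
      · rintro ⟨x, hx, hxs⟩
        have := hint s hsI x (hKsub hx) hxs
        subst this
        rcases hx with hx | hx
        · linarith [hx.2]
        · linarith [hx.1]
      · apply Subset.antisymm
        · rintro _ ⟨x, hx, rfl⟩
          by_cases c1 : x ≤ s - δ
          · left; exact ⟨x, Or.inl ⟨hx.1, c1⟩, rfl⟩
          by_cases c2 : s + δ ≤ x
          · left; exact ⟨x, Or.inr ⟨c2, hx.2⟩, rfl⟩
          push Not at c1 c2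
          right
          rcases le_total s x with c | c
          · left
            refine ⟨x - s, ⟨by linarith, by linarith⟩, ?_⟩
            have := h₁ (x - s) ⟨by linarith, by linarith⟩
            rw [add_sub_cancel] at this
            exact this.symm
          · right
            refine ⟨s - x, ⟨by linarith, by linarith⟩, ?_⟩
            have := h₂ (s - x) ⟨by linarith, by linarith⟩
            rw [sub_sub_cancel] at this
            exact this.symm
        · rintro _ (⟨x, hx, rfl⟩ | ⟨τ, hτ, rfl⟩ | ⟨τ, hτ, rfl⟩)
          · exact ⟨x, hKsub hx, rfl⟩
          · exact ⟨s + τ, ⟨by linarith [hτ.1, hs.1], by linarith [hτ.2]⟩,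
              h₁ τ ⟨hτ.1, hτ.2.trans d1⟩⟩
          · exact ⟨s - τ, ⟨by linarith [hτ.2], by linarith [hτ.1, hs.2]⟩,
              h₂ τ ⟨hτ.1, hτ.2.trans d2⟩⟩
    · have hgs : g s = g (t 0) := by
        by_cases c : s = t 0
        · rw [c]
        · have : s = t k := by
            by_contra c'
            exact hsI ⟨lt_of_le_of_ne hs.1 (Ne.symm c), lt_of_le_of_ne hs.2 c'⟩
          rw [this, hends]
      rw [hgs]
      obtain ⟨δ₁, hδ₁, hb₁, u, hu, h₁⟩ := hright (t 0) ⟨le_rfl, hab⟩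
      obtain ⟨δ₂, hδ₂, hb₂, v, hv, h₂⟩ := hleft (t k) ⟨hab, le_rfl⟩
      rw [← hends] at h₂
      set δ := min δ₁ δ₂ with hδ
      have hd : 0 < δ := lt_min hδ₁ hδ₂
      have d1 : δ ≤ δ₁ := min_le_left _ _
      have d2 : δ ≤ δ₂ := min_le_right _ _
      have hKsub : Icc (t 0 + δ) (t k - δ) ⊆ Icc (t 0) (t k) :=
        Icc_subset_Icc (by linarith) (by linarith)
      refine aux_local _ (g '' (Icc (t 0 + δ) (t k - δ))) (g (t 0)) u v δ hd hu hv
        (isCompact_Icc.image_of_continuousOn (hcont.mono hKsub)).isClosed ?_ ?_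
      · rintro ⟨x, hx, hxs⟩
        exact hint0 x ⟨by linarith [hx.1], by linarith [hx.2]⟩ hxs
      · apply Subset.antisymm
        · rintro _ ⟨x, hx, rfl⟩
          by_cases c1 : x ≤ t 0 + δ
          · right; left
            refine ⟨x - t 0, ⟨by linarith [hx.1], by linarith⟩, ?_⟩
            have := h₁ (x - t 0) ⟨by linarith [hx.1], by linarith⟩
            rw [add_sub_cancel] at this
            exact this.symm
          by_cases c2 : t k - δ ≤ x
          · right; right
            refine ⟨t k - x, ⟨by linarith [hx.2], by linarith⟩, ?_⟩
            have := h₂ (t k - x) ⟨by linarith [hx.2], by linarith⟩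
            rw [sub_sub_cancel] at this
            exact this.symm
          push Not at c1 c2
          left; exact ⟨x, ⟨c1.le, c2.le⟩, rfl⟩
        · rintro _ (⟨x, hx, rfl⟩ | ⟨τ, hτ, rfl⟩ | ⟨τ, hτ, rfl⟩)
          · exact ⟨x, hKsub hx, rfl⟩
          · exact ⟨t 0 + τ, ⟨by linarith [hτ.1], by linarith [hτ.2]⟩,
              h₁ τ ⟨hτ.1, hτ.2.trans d1⟩⟩
          · exact ⟨t k - τ, ⟨by linarith [hτ.2], by linarith [hτ.1]⟩,
              h₂ τ ⟨hτ.1, hτ.2.trans d2⟩⟩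

end PLJordanAux

/-- Jordan theorem for PL circuits: the complement is the disjoint union of
two nonempty open connected sets. -/
theorem pl_jordan (f : ℝ → ℝ × ℝ) (a b : ℝ) (hf : IsPLCircuit f a b) :
    ∃ A B : Set (ℝ × ℝ), IsOpen A ∧ IsOpen B ∧ A.Nonempty ∧ B.Nonempty ∧
      IsConnected A ∧ IsConnected B ∧ Disjoint A B ∧
      A ∪ B = (f '' Set.Icc a b)ᶜ := by
  obtain ⟨⟨k, t, hk, rfl, rfl, ht, hlin⟩, hab, hinj⟩ := hf
  let e := Complex.equivRealProdCLM
  obtain ⟨A, B, hA, hB, hAc, hBc, hd, hU⟩ := PLJordanAux.aux_main (fun x => e.symm (f x)) t k hk ht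
    (by
      intro i hi
      obtain ⟨u, v, hv, h⟩ := hlin i hi
      refine ⟨e.symm u, e.symm v, by simpa using hv, ?_⟩
      intro x hx
      simp only [h x hx, map_add, map_smul, Complex.real_smul])
    hab
    (by
      intro x hx y hy hxy
      rw [← hinj x hx y hy hxy]
      exact e.symm.injective.eq_iff)
  refine ⟨e '' A, e '' B, e.toHomeomorph.isOpenMap _ hA, e.toHomeomorph.isOpenMap _ hB,
    hAc.nonempty.image _, hBc.nonempty.image _, hAc.image _ e.continuous.continuousOn,
    hBc.image _ e.continuous.continuousOn, (Set.disjoint_image_iff e.injective).2 hd, ?_⟩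
  rw [← Set.image_union, hU, Set.image_compl_eq e.bijective, Set.image_image]
  simp
end
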